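/- arXiv:2010.14902 — 4 statements merged into one kernel-verified Lean document; each statement's English description precedes it below -/
import Mathlib

section
/- Let a = (a_1,…,a_{n−1}) ∈ {+1,−1}^{n−1} and let P(a) be the associated path-type partial order on {1,…,n}. Suppose there is some index j ≥ 2 with a_j = a_{j−1}, and let i ≥ 2 be the largest such index. Then the number of linear extensions strictly increases under right-side inversion at i: |L(P(a))| < |L(P(Φ_i(a)))|. (Proposition 3.10.) -/
/-- The left endpoint of the `i`-th edge of the path on `n` vertices. -/
def edgeIdx1 {n : ℕ} (i : Fin (n - 1)) : Fin n :=
  ⟨i.val, lt_of_lt_of_le i.isLt (Nat.sub_le n 1)⟩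

/-- The right endpoint of the `i`-th edge of the path on `n` vertices. -/
def edgeIdx2 {n : ℕ} (i : Fin (n - 1)) : Fin n :=
  ⟨i.val + 1, Nat.add_lt_of_lt_sub i.isLt⟩

/-- The generating (cover) relations of the path-type partial order on `{0,…,n-1}`
associated with the sign vector `a : Fin (n-1) → Bool` (`true` for `+1`, `false`
for `-1`): `i < i+1` when `a i = true`, and `i+1 < i` when `a i = false`. -/
def pathStep {n : ℕ} (a : Fin (n - 1) → Bool) (x y : Fin n) : Prop :=
  ∃ i : Fin (n - 1),
    (a i = true ∧ x = edgeIdx1 i ∧ y = edgeIdx2 i) ∨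
    (a i = false ∧ x = edgeIdx2 i ∧ y = edgeIdx1 i)

/-- The set of linear extensions of the path-type partial order of the sign vector
`a`: bijections of `{0,…,n-1}` which are strictly monotone on the partial order
generated by the cover relations of `a`. -/
def linExts {n : ℕ} (a : Fin (n - 1) → Bool) : Set (Equiv.Perm (Fin n)) :=
  {f | ∀ x y : Fin n, Relation.TransGen (pathStep a) x y → f x < f y}

/-- Right-side inversion at `i`: negate all entries of the sign vector from
position `i` onwards. -/
def rsInv {n : ℕ} (a : Fin (n - 1) → Bool) (i : Fin (n - 1)) : Fin (n - 1) → Bool :=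
  fun j => if j < i then a j else !(a j)

section

open Finset

/-- The permutations of `{0,…,m}` whose ascents are exactly the positions `k` with `s k = true`. -/
def sigPerms (s : ℕ → Bool) (m : ℕ) : Finset (Equiv.Perm (Fin (m + 1))) :=
  {f | ∀ k : Fin m, s k = true ↔ f k.castSucc < f k.succ}

/-- The number of permutations in `sigPerms s m` with last value `j`. -/
def rankCount (s : ℕ → Bool) (m j : ℕ) : ℕ :=
  #{f ∈ sigPerms s m | (f (Fin.last m) : ℕ) = j}

/-- The number of ways to append `k` further values to a permutation of `{0,…,m}` with last
value `j`, following the signs `s m, …, s (m + k - 1)`. -/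
def tailCount (s : ℕ → Bool) : ℕ → ℕ → ℕ → ℕ
  | 0, _, _ => 1
  | k + 1, m, j => ∑ i ∈ range (m + 2) with (s m = true ↔ j < i), tailCount s k (m + 1) i

/-- Append the last value `j` to a permutation, shifting the values from `j` on. -/
def snocPerm {m : ℕ} (j : Fin (m + 2)) (p : Equiv.Perm (Fin (m + 1))) :
    Equiv.Perm (Fin (m + 2)) :=
  ((finSuccEquiv' (Fin.last (m + 1))).trans (Equiv.optionCongr p)).trans (finSuccEquiv' j).symm

@[simp]
theorem snocPerm_last {m : ℕ} (j : Fin (m + 2)) (p : Equiv.Perm (Fin (m + 1))) :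
    snocPerm j p (Fin.last (m + 1)) = j := by
  simp [snocPerm]

@[simp]
theorem snocPerm_castSucc {m : ℕ} (j : Fin (m + 2)) (p : Equiv.Perm (Fin (m + 1)))
    (k : Fin (m + 1)) : snocPerm j p k.castSucc = j.succAbove (p k) := by
  simp [snocPerm, finSuccEquiv'_below (Fin.castSucc_lt_last k)]

theorem snocPerm_injective {m : ℕ} :
    Function.Injective fun x : Fin (m + 2) × Equiv.Perm (Fin (m + 1)) => snocPerm x.1 x.2 := by
  rintro ⟨j, p⟩ ⟨j', p'⟩ h
  replace h : snocPerm j p = snocPerm j' p' := h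
  obtain rfl : j = j' := by
    simpa using congrArg (fun f => f (Fin.last (m + 1))) h
  congr 1
  ext k : 1
  have := congrArg (fun f => f k.castSucc) h
  simpa using this

theorem snocPerm_bijective {m : ℕ} :
    Function.Bijective fun x : Fin (m + 2) × Equiv.Perm (Fin (m + 1)) => snocPerm x.1 x.2 := by
  rw [Fintype.bijective_iff_injective_and_card]
  exact ⟨snocPerm_injective, by
    simp [Fintype.card_perm, Nat.factorial_succ (m + 1)]⟩

theorem snocPerm_mem_sigPerms {s : ℕ → Bool} {m : ℕ} {j : Fin (m + 2)}
    {p : Equiv.Perm (Fin (m + 1))} :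
    snocPerm j p ∈ sigPerms s (m + 1) ↔
      p ∈ sigPerms s m ∧ (s m = true ↔ (p (Fin.last m) : ℕ) < j) := by
  simp only [sigPerms, mem_filter, mem_univ, true_and]
  rw [Fin.forall_fin_succ']
  refine and_congr (forall_congr' fun k => ?_) ?_
  · rw [Fin.succ_castSucc, snocPerm_castSucc, snocPerm_castSucc, Fin.succAbove_lt_succAbove_iff]
    simp
  · rw [Fin.succ_last, snocPerm_last, snocPerm_castSucc, Fin.succAbove_lt_iff_castSucc_lt]
    simp [Fin.lt_def]

theorem rankCount_succ (s : ℕ → Bool) {m j : ℕ} (hj : j < m + 2) :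
    rankCount s (m + 1) j =
      ∑ i ∈ range (m + 1) with (s m = true ↔ i < j), rankCount s m i := by
  have h1 : rankCount s (m + 1) j =
      #{p ∈ sigPerms s m | (s m = true ↔ (p (Fin.last m) : ℕ) < j)} := by
    symm
    refine card_bij (fun p _ => snocPerm ⟨j, hj⟩ p) ?_ ?_ ?_
    · intro p hp
      rw [mem_filter] at hp
      rw [mem_filter, snocPerm_mem_sigPerms]
      exact ⟨hp, by simp⟩
    · intro p _ q _ h
      exact (Prod.ext_iff.1 (snocPerm_injective (a₁ := (⟨j, hj⟩, p)) (a₂ := (⟨j, hj⟩, q)) h)).2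
    · intro f hf
      obtain ⟨⟨j', p⟩, rfl⟩ := snocPerm_bijective.2 f
      simp only [mem_filter, snocPerm_mem_sigPerms, snocPerm_last] at hf
      obtain ⟨hf, rfl⟩ := hf
      exact ⟨p, mem_filter.2 hf, rfl⟩
  rw [h1, card_eq_sum_card_fiberwise (f := fun p => (p (Fin.last m) : ℕ))
    (t := {i ∈ range (m + 1) | (s m = true ↔ i < j)})]
  · refine sum_congr rfl fun i hi => ?_
    rw [mem_filter] at hi
    rw [rankCount, filter_filter]
    congr 1
    refine filter_congr fun p _ => ?_
    constructor
    · exact fun h => h.2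
    · rintro rfl
      exact ⟨hi.2, rfl⟩
  · intro p hp
    simp only [coe_filter, Set.mem_ofPred_eq, mem_range] at hp ⊢
    exact ⟨(p (Fin.last m)).isLt, hp.2⟩

theorem card_sigPerms (s : ℕ → Bool) {N k m : ℕ} (h : N = m + k) :
    #(sigPerms s N) = ∑ j ∈ range (m + 1), rankCount s m j * tailCount s k m j := by
  induction k generalizing m with
  | zero =>
    subst h
    simp only [tailCount, mul_one]
    exact card_eq_sum_card_fiberwise fun p _ => by
      simpa using (p (Fin.last N)).is_le
  | succ k ih =>
    rw [ih (m := m + 1) (by omega)]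
    calc _ = ∑ i ∈ range (m + 2), ∑ j ∈ range (m + 1), (if (s m = true ↔ j < i) then
            rankCount s m j * tailCount s k (m + 1) i else 0) := by
          refine sum_congr rfl fun i hi => ?_
          rw [rankCount_succ s (mem_range.1 hi), sum_filter, sum_mul]
          simp only [ite_mul, zero_mul]
      _ = _ := by
          rw [sum_comm]
          refine sum_congr rfl fun j _ => ?_
          rw [tailCount, sum_filter, mul_sum]
          simp only [mul_ite, mul_zero]

theorem rankCount_congr {s s' : ℕ → Bool} {m : ℕ} (h : ∀ k < m, s k = s' k) (j : ℕ) :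
    rankCount s m j = rankCount s' m j := by
  have : sigPerms s m = sigPerms s' m :=
    filter_congr fun f _ => forall_congr' fun k => by rw [h k k.isLt]
  rw [rankCount, rankCount, this]

theorem tailCount_compl {s s' : ℕ → Bool} (k : ℕ) {m j : ℕ} (h : ∀ l, m ≤ l → s' l = !s l)
    (hj : j ≤ m) : tailCount s' k m j = tailCount s k m (m - j) := by
  induction k generalizing m j with
  | zero => rfl
  | succ k ih =>
    rw [tailCount, tailCount, sum_filter, sum_filter, ← sum_range_reflect]
    refine sum_congr rfl fun i hi => ?_
    rw [mem_range] at hi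
    rw [ih (fun l hl => h l (by omega)) (by omega), h m le_rfl]
    have h1 : m + 1 - (m + 2 - 1 - i) = i := by omega
    have h2 : j < m + 2 - 1 - i ↔ ¬ m - j < i := by omega
    rw [h1]
    simp only [h2]
    cases s m <;> simp

theorem tailCount_pos (s : ℕ → Bool) (k : ℕ) {m j : ℕ} (hj : j ≤ m) : 0 < tailCount s k m j := by
  induction k generalizing m j with
  | zero => exact Nat.one_pos
  | succ k ih =>
    refine sum_pos (fun i hi => ih ?_) ?_
    · simp only [mem_filter, mem_range] at hi
      omega
    · refine ⟨if s m = true then m + 1 else 0, ?_⟩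
      cases h : s m <;> simp <;> omega

theorem exists_rankCount_pos (s : ℕ → Bool) (m : ℕ) : ∃ j ≤ m, 0 < rankCount s m j := by
  induction m with
  | zero =>
    refine ⟨0, le_rfl, card_pos.2 ⟨1, ?_⟩⟩
    simp [sigPerms]
  | succ m ih =>
    obtain ⟨i, hi, hpos⟩ := ih
    refine ⟨if s m = true then m + 1 else 0, by split_ifs <;> omega, ?_⟩
    rw [rankCount_succ s (by split_ifs <;> omega)]
    refine sum_pos' (fun _ _ => Nat.zero_le _) ⟨i, ?_, hpos⟩
    cases h : s m
    · simp
      omega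
    · simp
      omega

theorem sum_mul_lt_sum_mul_reflect {m : ℕ} {v t : ℕ → ℤ}
    (h : ∀ j ≤ m, 0 ≤ (v (m - j) - v j) * (t j - t (m - j)))
    (h0 : 0 < (v m - v 0) * (t 0 - t m)) :
    ∑ j ∈ range (m + 1), v j * t j < ∑ j ∈ range (m + 1), v j * t (m - j) := by
  have hpos : 0 < ∑ j ∈ range (m + 1), (v (m - j) - v j) * (t j - t (m - j)) :=
    sum_pos' (fun j hj => h j (by simpa [Nat.lt_succ_iff] using hj)) ⟨0, by simp, by simpa using h0⟩
  have h1 := sum_flip (n := m) fun j => v j * t j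
  have h2 : ∑ j ∈ range (m + 1), v (m - j) * t j = ∑ j ∈ range (m + 1), v j * t (m - j) := by
    rw [← sum_flip]
    refine sum_congr rfl fun j hj => ?_
    rw [Nat.sub_sub_self (by simpa [Nat.lt_succ_iff] using hj)]
  simp only [sub_mul, mul_sub, sum_sub_distrib, h1, h2] at hpos
  linarith

theorem rankCount_succ_mono {s : ℕ → Bool} {m : ℕ} (hs : s m = true) {j j' : ℕ} (hjj : j ≤ j')
    (hj : j' < m + 2) : rankCount s (m + 1) j ≤ rankCount s (m + 1) j' := by
  rw [rankCount_succ s hj, rankCount_succ s (by omega)]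
  refine sum_le_sum_of_subset fun i hi => ?_
  simp only [hs, mem_filter, true_iff] at hi ⊢
  exact ⟨hi.1, by omega⟩

theorem rankCount_succ_anti {s : ℕ → Bool} {m : ℕ} (hs : s m = false) {j j' : ℕ} (hjj : j ≤ j')
    (hj : j' < m + 2) : rankCount s (m + 1) j' ≤ rankCount s (m + 1) j := by
  rw [rankCount_succ s hj, rankCount_succ s (by omega)]
  refine sum_le_sum_of_subset fun i hi => ?_
  simp only [hs, mem_filter, Bool.false_eq_true, false_iff] at hi ⊢
  exact ⟨hi.1, by omega⟩

theorem rankCount_succ_zero_lt {s : ℕ → Bool} {m : ℕ} (hs : s m = true) :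
    rankCount s (m + 1) 0 < rankCount s (m + 1) (m + 1) := by
  obtain ⟨i, hi, hpos⟩ := exists_rankCount_pos s m
  rw [rankCount_succ s (by omega), rankCount_succ s (by omega)]
  refine sum_lt_sum_of_subset (i := i) ?_ ?_ ?_ hpos fun _ _ _ => Nat.zero_le _
  · intro i
    simp [hs]
  · simp [hs]; omega
  · simp [hs]

theorem rankCount_succ_last_lt {s : ℕ → Bool} {m : ℕ} (hs : s m = false) :
    rankCount s (m + 1) (m + 1) < rankCount s (m + 1) 0 := by
  obtain ⟨i, hi, hpos⟩ := exists_rankCount_pos s m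
  rw [rankCount_succ s (by omega), rankCount_succ s (by omega)]
  refine sum_lt_sum_of_subset (i := i) ?_ ?_ ?_ hpos fun _ _ _ => Nat.zero_le _
  · intro i
    simp [hs]
  · simp [hs]; omega
  · simp [hs]

theorem tailCount_succ_anti {s : ℕ → Bool} {k m : ℕ} (hs : s m = true) {j j' : ℕ} (hjj : j < j')
    (hj : j' ≤ m) : tailCount s (k + 1) m j' < tailCount s (k + 1) m j := by
  rw [tailCount, tailCount]
  refine sum_lt_sum_of_subset (i := j') ?_ ?_ ?_ (tailCount_pos s k (by omega))
    fun _ _ _ => Nat.zero_le _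
  · intro i
    simp [hs]; omega
  · simp [hs]; omega
  · simp [hs]

theorem tailCount_succ_mono {s : ℕ → Bool} {k m : ℕ} (hs : s m = false) {j j' : ℕ} (hjj : j < j')
    (hj : j' ≤ m) : tailCount s (k + 1) m j < tailCount s (k + 1) m j' := by
  rw [tailCount, tailCount]
  refine sum_lt_sum_of_subset (i := j') ?_ ?_ ?_ (tailCount_pos s k (by omega))
    fun _ _ _ => Nat.zero_le _
  · intro i
    simp [hs]; omega
  · simp [hs]; omega
  · simp [hs]; omega

theorem card_sigPerms_lt {s s' : ℕ → Bool} {N m : ℕ} (hm : m + 1 < N) (heq : s (m + 1) = s m)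
    (hlt : ∀ k < m + 1, s k = s' k) (hge : ∀ k, m + 1 ≤ k → s' k = !s k) :
    #(sigPerms s N) < #(sigPerms s' N) := by
  obtain ⟨k, rfl⟩ : ∃ k, N = m + 1 + (k + 1) := ⟨N - m - 2, by omega⟩
  rw [card_sigPerms s rfl, card_sigPerms s' rfl]
  have hr : ∑ j ∈ range (m + 1 + 1), rankCount s' (m + 1) j * tailCount s' (k + 1) (m + 1) j =
      ∑ j ∈ range (m + 1 + 1),
        rankCount s (m + 1) j * tailCount s (k + 1) (m + 1) (m + 1 - j) := by
    refine sum_congr rfl fun j hj => ?_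
    rw [rankCount_congr hlt, tailCount_compl (k + 1) hge (by simpa [Nat.lt_succ_iff] using hj)]
  rw [hr]
  zify
  refine sum_mul_lt_sum_mul_reflect (v := fun j => (rankCount s (m + 1) j : ℤ))
    (t := fun j => (tailCount s (k + 1) (m + 1) j : ℤ)) ?_ ?_
  · intro j hj
    cases hs : s m with
    | true =>
      rcases lt_trichotomy j (m + 1 - j) with h | h | h
      · have h1 := rankCount_succ_mono hs h.le (by omega)
        have h2 := tailCount_succ_anti (k := k) (heq.trans hs) h (by omega)
        apply mul_nonneg <;> simp only [sub_nonneg, Nat.cast_le] <;> omega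
      · simp [← h]
      · have h1 := rankCount_succ_mono hs h.le (by omega)
        have h2 := tailCount_succ_anti (k := k) (heq.trans hs) h (by omega)
        apply mul_nonneg_of_nonpos_of_nonpos <;> simp only [sub_nonpos, Nat.cast_le] <;> omega
    | false =>
      rcases lt_trichotomy j (m + 1 - j) with h | h | h
      · have h1 := rankCount_succ_anti hs h.le (by omega)
        have h2 := tailCount_succ_mono (k := k) (heq.trans hs) h (by omega)
        apply mul_nonneg_of_nonpos_of_nonpos <;> simp only [sub_nonpos, Nat.cast_le] <;> omega
      · simp [← h]
      · have h1 := rankCount_succ_anti hs h.le (by omega)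
        have h2 := tailCount_succ_mono (k := k) (heq.trans hs) h (by omega)
        apply mul_nonneg <;> simp only [sub_nonneg, Nat.cast_le] <;> omega
  · cases hs : s m with
    | true =>
      have h1 := rankCount_succ_zero_lt hs
      have h2 := tailCount_succ_anti (k := k) (heq.trans hs) (Nat.succ_pos m) le_rfl
      apply mul_pos <;> simp only [sub_pos, Nat.cast_lt] <;> omega
    | false =>
      have h1 := rankCount_succ_last_lt hs
      have h2 := tailCount_succ_mono (k := k) (heq.trans hs) (Nat.succ_pos m) le_rfl
      apply mul_pos_of_neg_of_neg <;> simp only [sub_neg, Nat.cast_lt] <;> omega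

theorem mem_linExts_iff {n : ℕ} {a : Fin (n - 1) → Bool} {f : Equiv.Perm (Fin n)} :
    f ∈ linExts a ↔ ∀ x y, pathStep a x y → f x < f y := by
  refine ⟨fun h x y hxy => h x y (.single hxy), fun h x y hxy => ?_⟩
  induction hxy with
  | single hxy => exact h _ _ hxy
  | tail _ hyz ih => exact ih.trans (h _ _ hyz)

theorem linExts_eq_sigPerms {N : ℕ} (a : Fin (N + 1 - 1) → Bool) {s : ℕ → Bool}
    (hs : ∀ k : Fin N, s k = a k) : linExts a = ↑(sigPerms s N) := by
  ext f
  rw [mem_linExts_iff]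
  simp only [sigPerms, coe_filter, mem_univ, true_and, Set.mem_ofPred_eq]
  constructor
  · intro h k
    rw [hs k]
    cases hk : a k with
    | true => simpa using h k.castSucc k.succ ⟨k, .inl ⟨hk, rfl, rfl⟩⟩
    | false => simpa using (h k.succ k.castSucc ⟨k, .inr ⟨hk, rfl, rfl⟩⟩).le
  · rintro h x y ⟨k, ⟨hk, rfl, rfl⟩ | ⟨hk, rfl, rfl⟩⟩
    · exact (h k).1 ((hs k).trans hk)
    · have h1 : ¬ f (Fin.castSucc k) < f (Fin.succ k) := fun h2 => by
        have := (h k).2 h2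
        rw [hs k, hk] at this
        cases this
      refine lt_of_le_of_ne (not_lt.1 h1) fun h2 => ?_
      exact (Fin.castSucc_lt_succ (i := k)).ne' (f.injective h2)

end

/-- Proposition 3.10: if `i` is the largest index with `a i = a (i-1)`,
then right-side inversion at `i` strictly increases the number of linear extensions
of the associated path-type partial order. -/
theorem stmt12 (n : ℕ) (a : Fin (n - 1) → Bool) (i : Fin (n - 1)) (hi : 0 < i.val)
    (heq : a i = a ⟨i.val - 1, lt_of_le_of_lt (Nat.sub_le _ _) i.isLt⟩)
    (hmax : ∀ j : Fin (n - 1), i < j →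
      a j ≠ a ⟨j.val - 1, lt_of_le_of_lt (Nat.sub_le _ _) j.isLt⟩) :
    (linExts a).ncard < (linExts (rsInv a i)).ncard := by
  obtain ⟨N, rfl⟩ : ∃ N, n = N + 1 := ⟨n - 1, by have := i.isLt; omega⟩
  obtain ⟨_ | m, hiN⟩ := i
  · exact absurd hi (lt_irrefl 0)
  replace hiN : m + 1 < N := hiN
  let s : ℕ → Bool := fun k => if h : k < N then a ⟨k, h⟩ else true
  let s' : ℕ → Bool := fun k => if k < m + 1 then s k else !s k
  have hs (k : Fin N) : s k = a k := by simp [s]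
  have hs' (k : Fin N) : s' k = rsInv a ⟨m + 1, hiN⟩ k := by
    simp only [s', hs, rsInv, Fin.lt_def]
  rw [linExts_eq_sigPerms a hs, linExts_eq_sigPerms _ hs', Set.ncard_coe_finset,
    Set.ncard_coe_finset]
  refine card_sigPerms_lt hiN ?_ (fun k hk => ?_) fun k hk => ?_
  · exact (hs ⟨m + 1, hiN⟩).trans (heq.trans (hs ⟨m, by omega⟩).symm)
  · exact (if_pos hk).symm
  · exact if_neg (not_lt.2 hk)
end

section
/- Consider the path on n+1 vertices (n ≥ 3) labeled 1,…,n+1 consecutively, and let c_0 be the canonical cycle (1,3,5,…,6,4,2), the (n+1)-cycle listing odd vertices in increasing order followed by even vertices in decreasing order. Then c_0 and its inverse have the same multiplicity, and for every cycle c realized as the product of some edge ordering, if c ∉ {c_0, c_0^{−1}} then the multiplicity of c is strictly smaller than that of c_0. (Theorem 3.11.) -/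
/-- The transposition of `Sₙ` corresponding to an edge (an unordered pair) of a graph
on the vertex set `Fin n`. -/
def edgePerm {n : ℕ} (e : Sym2 (Fin n)) : Equiv.Perm (Fin n) :=
  Sym2.lift ⟨fun i j => Equiv.swap i j, fun i j => Equiv.swap_comm i j⟩ e

/-- The product of the transpositions of a list of edges, the first edge applied first. -/
def listProd {n : ℕ} (l : List (Sym2 (Fin n))) : Equiv.Perm (Fin n) :=
  (l.map edgePerm).reverse.prod

/-- The `i`-th edge `{i, i+1}` of the path on `n` vertices `0, 1, …, n-1`. -/
def pathEdge {n : ℕ} (i : Fin (n - 1)) : Sym2 (Fin n) := s(edgeIdx1 i, edgeIdx2 i)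

/-- `l` is an edge ordering of the path on `n` vertices: a duplicate-free list
containing exactly the edges of the path. -/
def IsPathOrdering (n : ℕ) (l : List (Sym2 (Fin n))) : Prop :=
  l.Nodup ∧ ∀ e, e ∈ l ↔ ∃ i : Fin (n - 1), e = pathEdge i

/-- The multiplicity of the permutation `c` for the path on `n` vertices:
the number of edge orderings whose product is `c`. -/
noncomputable def pathMult (n : ℕ) (c : Equiv.Perm (Fin n)) : ℕ :=
  {l : List (Sym2 (Fin n)) | IsPathOrdering n l ∧ listProd l = c}.ncard

section AlternatingOrderings

open Equiv Finset

/-- The adjacent transposition `(i, i + 1)` of `ℕ`. -/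
def adjSwap (i : ℕ) : Perm ℕ := swap i (i + 1)

/-- The product of the adjacent transpositions indexed by a list, the first one applied first. -/
def adjProd (l : List ℕ) : Perm ℕ := (l.map adjSwap).reverse.prod

theorem adjProd_append (a b : List ℕ) : adjProd (a ++ b) = adjProd b * adjProd a := by
  simp [adjProd]

theorem adjProd_cons (i : ℕ) (l : List ℕ) : adjProd (i :: l) = adjProd l * adjSwap i := by
  simp [adjProd]

theorem adjSwap_mul_self (i : ℕ) : adjSwap i * adjSwap i = 1 := swap_mul_self _ _

theorem adjSwap_comm {i j : ℕ} (h : i + 1 < j) : adjSwap j * adjSwap i = adjSwap i * adjSwap j := by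
  ext x
  simp only [adjSwap, Perm.mul_apply, swap_apply_def]
  split_ifs <;> omega

theorem adjSwap_mul_adjProd {j : ℕ} {l : List ℕ} (h : ∀ i ∈ l, i + 1 < j) :
    adjSwap j * adjProd l = adjProd l * adjSwap j := by
  induction l with
  | nil => simp [adjProd]
  | cons i l ih =>
    simp only [List.mem_cons, forall_eq_or_imp] at h
    rw [adjProd_cons, ← mul_assoc, ih h.2, mul_assoc, adjSwap_comm h.1, mul_assoc]

theorem adjProd_apply_of_lt {x : ℕ} {l : List ℕ} (h : ∀ i ∈ l, i + 1 < x) : adjProd l x = x := by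
  induction l with
  | nil => simp [adjProd]
  | cons i l ih =>
    simp only [List.mem_cons, forall_eq_or_imp] at h
    rw [adjProd_cons, Perm.mul_apply, adjSwap, swap_apply_of_ne_of_ne (by omega) (by omega), ih h.2]

theorem adjProd_apply_ne {t : ℕ} {l : List ℕ} (h : l.Perm (List.range (t + 1))) :
    adjProd l (t + 1) ≠ t + 1 := by
  have ht : t ∈ l := h.mem_iff.2 (by simp)
  obtain ⟨a, b, rfl⟩ := List.append_of_mem ht
  have hnd : (a ++ t :: b).Nodup := h.nodup_iff.2 List.nodup_range
  have hlt : ∀ i ∈ a ++ t :: b, i < t + 1 := fun i hi => by simpa using h.mem_iff.1 hi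
  have hne : ∀ i, i ∈ a ∨ i ∈ b → i + 1 < t + 1 := by
    intro i hi
    have h1 := hlt i (by rcases hi with hi | hi <;> simp [hi])
    have h2 : i ≠ t := by
      rintro rfl
      rw [List.nodup_middle] at hnd
      simp only [List.nodup_cons, List.mem_append] at hnd
      exact hnd.1 hi
    omega
  rw [adjProd_append, adjProd_cons, Perm.mul_apply, Perm.mul_apply,
    adjProd_apply_of_lt fun i hi => hne i (Or.inl hi)]
  intro hx
  have h2 := adjProd_apply_of_lt fun i hi => hne i (Or.inr hi)
  have h3 := (adjProd b).injective (hx.trans h2.symm)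
  simp [adjSwap] at h3

/-- Inserting the index `t + 1` into an ordering of `0, …, t` multiplies the product by the new
transposition, on a side that depends on whether it is inserted after or before `t`. -/
theorem adjProd_insert {t : ℕ} {a b : List ℕ} (h : (a ++ b).Perm (List.range (t + 1))) :
    adjProd (a ++ (t + 1) :: b) =
      if (a ++ b).idxOf t < a.length then adjSwap (t + 1) * adjProd (a ++ b)
      else adjProd (a ++ b) * adjSwap (t + 1) := by
  have hnd : (a ++ b).Nodup := h.nodup_iff.2 List.nodup_range
  have hlt : ∀ i ∈ a ++ b, i < t + 1 := fun i hi => by simpa using h.mem_iff.1 hi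
  rw [adjProd_append, adjProd_append, adjProd_cons]
  by_cases hta : t ∈ a
  · have htb : t ∉ b := fun hb => (List.nodup_append.1 hnd).2.2 t hta t hb rfl
    rw [if_pos (by rw [List.idxOf_append_of_mem hta]; exact List.idxOf_lt_length_of_mem hta),
      ← mul_assoc, adjSwap_mul_adjProd]
    intro i hi
    have h1 := hlt i (by simp [hi])
    have h2 : i ≠ t := by rintro rfl; exact htb hi
    omega
  · rw [if_neg (by rw [List.idxOf_append_of_notMem hta]; omega), mul_assoc, mul_assoc,
      adjSwap_mul_adjProd]
    intro i hi
    have h1 := hlt i (by simp [hi])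
    have h2 : i ≠ t := by rintro rfl; exact hta hi
    omega

/-- The product attached to an up-down word, its head telling whether the last edge comes after
(`true`) or before (`false`) the previous one. -/
def wordProd : List Bool → Perm ℕ
  | [] => adjSwap 0
  | true :: w => adjSwap (w.length + 1) * wordProd w
  | false :: w => wordProd w * adjSwap (w.length + 1)

/-- The number of orderings with a given up-down word in which the last edge has position `k`. -/
def wordCount : List Bool → ℕ → ℕ
  | [], k => if k = 0 then 1 else 0
  | true :: w, k => if k ≤ w.length + 1 then ∑ j ∈ range k, wordCount w j else 0
  | false :: w, k => ∑ j ∈ Ico k (w.length + 1), wordCount w j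

/-- The number of orderings with a given up-down word. -/
def wordTotal (w : List Bool) : ℕ := ∑ k ∈ range (w.length + 1), wordCount w k

/-- The orderings of `0, …, m - 1`. -/
def orderings (m : ℕ) : Finset (List ℕ) := (List.range m).permutations.toFinset

theorem mem_orderings {m : ℕ} {l : List ℕ} : l ∈ orderings m ↔ l.Perm (List.range m) := by
  simp [orderings]

open Classical in
/-- The orderings with product `c` in which the largest index has position `k`. -/
noncomputable def posOrderings (t : ℕ) (c : Perm ℕ) (k : ℕ) : Finset (List ℕ) :=
  (orderings (t + 1)).filter fun l => adjProd l = c ∧ l.idxOf t = k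

theorem orderings_lt {m : ℕ} {l : List ℕ} (h : l.Perm (List.range m)) {i : ℕ} (hi : i ∈ l) :
    i < m := by simpa using h.mem_iff.1 hi

theorem perm_insert {m : ℕ} {a b : List ℕ} :
    (a ++ m :: b).Perm (List.range (m + 1)) ↔ (a ++ b).Perm (List.range m) := by
  rw [List.range_succ]
  constructor
  · intro h
    exact (List.perm_cons m).1 ((List.perm_middle.symm.trans h).trans List.perm_append_comm)
  · intro h
    exact (List.perm_middle.trans (h.cons m)).trans (List.perm_append_comm (l₁ := [m]))

theorem card_filter_orderings_succ (t k : ℕ) (hk : k ≤ t + 1) (p : List ℕ → Prop)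
    [DecidablePred p] :
    ((orderings (t + 1 + 1)).filter fun l => p l ∧ l.idxOf (t + 1) = k).card =
      ((orderings (t + 1)).filter fun l => p (l.take k ++ (t + 1) :: l.drop k)).card := by
  symm
  apply card_nbij' (fun l => l.take k ++ (t + 1) :: l.drop k) (fun l => l.erase (t + 1))
  · intro l hl
    simp only [coe_filter, mem_orderings, Set.mem_ofPred_eq] at hl ⊢
    have hn : t + 1 ∉ l := fun h => by have := orderings_lt hl.1 h; omega
    have hlen : l.length = t + 1 := by simpa using hl.1.length_eq
    refine ⟨perm_insert.2 (by simpa using hl.1), hl.2, ?_⟩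
    rw [List.idxOf_append_of_notMem fun h => hn (List.mem_of_mem_take h)]
    simp [hlen, hk]
  · intro l hl
    simp only [coe_filter, mem_orderings, Set.mem_ofPred_eq] at hl ⊢
    obtain ⟨hl, hp, hi⟩ := hl
    have ht : t + 1 ∈ l := hl.mem_iff.2 (by simp)
    obtain ⟨a, b, rfl, ha⟩ := List.eq_append_cons_of_mem ht
    rw [List.idxOf_append_of_notMem ha] at hi
    simp only [List.idxOf_cons_self, Nat.add_zero] at hi
    subst hi
    rw [List.erase_append_right _ ha]
    simp only [List.erase_cons_head]
    exact ⟨perm_insert.1 hl, by simpa using hp⟩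
  · intro l hl
    simp only [coe_filter, mem_orderings, Set.mem_ofPred_eq] at hl
    have hn : t + 1 ∉ l := fun h => by have := orderings_lt hl.1 h; omega
    beta_reduce
    rw [List.erase_append_right _ fun h => hn (List.mem_of_mem_take h)]
    simp
  · intro l hl
    simp only [coe_filter, mem_orderings, Set.mem_ofPred_eq] at hl
    obtain ⟨hl, hp, hi⟩ := hl
    have ht : t + 1 ∈ l := hl.mem_iff.2 (by simp)
    obtain ⟨a, b, rfl, ha⟩ := List.eq_append_cons_of_mem ht
    rw [List.idxOf_append_of_notMem ha] at hi
    simp only [List.idxOf_cons_self, Nat.add_zero] at hi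
    subst hi
    beta_reduce
    rw [List.erase_append_right _ ha]
    simp

theorem wordProd_apply_of_lt (w : List Bool) {x : ℕ} (h : w.length + 1 < x) :
    wordProd w x = x := by
  induction w with
  | nil =>
    simp only [List.length_nil] at h
    exact swap_apply_of_ne_of_ne (by omega) (by omega)
  | cons b w ih =>
    simp only [List.length_cons] at h
    have h1 : adjSwap (w.length + 1) x = x := swap_apply_of_ne_of_ne (by omega) (by omega)
    cases b <;> simp [wordProd, h1, ih (by omega)]

open Classical in
theorem card_posOrderings_eq_sum (t : ℕ) (c : Perm ℕ) (s : Finset ℕ) :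
    ((orderings (t + 1)).filter fun l => adjProd l = c ∧ l.idxOf t ∈ s).card =
      ∑ j ∈ s, (posOrderings t c j).card := by
  rw [card_eq_sum_card_fiberwise (f := fun l => l.idxOf t) (t := s)]
  · refine sum_congr rfl fun j hj => ?_
    congr 1
    ext l
    simp only [posOrderings, mem_filter]
    grind
  · intro l hl
    simp at hl ⊢
    exact hl.2.2

theorem card_posOrderings (w : List Bool) (k : ℕ) :
    (posOrderings w.length (wordProd w) k).card = wordCount w k := by
  classical
  induction w generalizing k with
  | nil =>
    have : orderings 1 = {[0]} := by ext l; simp [mem_orderings]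
    simp only [posOrderings, wordCount, List.length_nil, zero_add, this, filter_singleton]
    by_cases hk : k = 0
    · subst hk; simp [adjProd, wordProd]
    · simp [hk, Ne.symm hk]
  | cons b w ih =>
    have hbig : ¬ k ≤ w.length + 1 → posOrderings (w.length + 1) (wordProd (b :: w)) k = ∅ := by
      intro hk
      rw [posOrderings, filter_eq_empty_iff]
      rintro l hl ⟨-, h⟩
      rw [mem_orderings] at hl
      have h1 : l.length = w.length + 1 + 1 := by simpa using hl.length_eq
      have h2 := List.idxOf_lt_length_of_mem (hl.mem_iff.2 (by simp) : w.length + 1 ∈ l)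
      omega
    have key : ∀ l : List ℕ, l.Perm (List.range (w.length + 1)) → k ≤ w.length + 1 →
        adjProd (l.take k ++ (w.length + 1) :: l.drop k) =
        if l.idxOf w.length < k then adjSwap (w.length + 1) * adjProd l
        else adjProd l * adjSwap (w.length + 1) := by
      intro l hl hk
      have hlen : l.length = w.length + 1 := by simpa using hl.length_eq
      have := adjProd_insert (t := w.length) (a := l.take k) (b := l.drop k) (by simpa using hl)
      simpa [hlen, hk] using this
    have hne : ∀ l : List ℕ, l.Perm (List.range (w.length + 1)) →
        adjProd l * adjSwap (w.length + 1) ≠ adjSwap (w.length + 1) * wordProd w := by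
      intro l hl h
      have h1 := congrArg (fun σ => σ (w.length + 1 + 1)) h
      simp only [Perm.mul_apply, wordProd_apply_of_lt w (Nat.lt_succ_self _)] at h1
      simp only [adjSwap, swap_apply_right] at h1
      exact adjProd_apply_ne hl h1
    have hne' : ∀ l : List ℕ, l.Perm (List.range (w.length + 1)) →
        adjSwap (w.length + 1) * adjProd l ≠ wordProd w * adjSwap (w.length + 1) := by
      intro l hl h
      apply hne l hl
      rw [← mul_right_inj (adjSwap (w.length + 1)), ← mul_assoc, h, mul_assoc, adjSwap_mul_self,
        mul_one, ← mul_assoc, adjSwap_mul_self, one_mul]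
    cases b with
    | true =>
      simp only [wordCount, List.length_cons]
      split_ifs with hk
      · rw [posOrderings, card_filter_orderings_succ _ _ hk]
        simp only [← ih]
        rw [← card_posOrderings_eq_sum]
        congr 1
        apply filter_congr
        intro l hl
        rw [mem_orderings] at hl
        rw [key l hl hk]
        split_ifs with h
        · simp [wordProd, h]
        · simp [wordProd, h, hne l hl]
      · rw [hbig hk, card_empty]
    | false =>
      simp only [wordCount, List.length_cons]
      by_cases hk : k ≤ w.length + 1
      · rw [posOrderings, card_filter_orderings_succ _ _ hk]
        simp only [← ih]
        rw [← card_posOrderings_eq_sum]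
        congr 1
        apply filter_congr
        intro l hl
        have hlt : l.idxOf w.length < w.length + 1 := by
          rw [mem_orderings] at hl
          have h1 : l.length = w.length + 1 := by simpa using hl.length_eq
          have h2 := List.idxOf_lt_length_of_mem (hl.mem_iff.2 (by simp) : w.length ∈ l)
          omega
        rw [mem_orderings] at hl
        rw [key l hl hk]
        split_ifs with h
        · simp [wordProd, h, hne' l hl]
        · simp [wordProd, not_lt.1 h, hlt]
      · rw [hbig hk, card_empty, Ico_eq_empty (by omega), sum_empty]

open Classical in
theorem card_orderings_wordProd (w : List Bool) :
    ((orderings (w.length + 1)).filter fun l => adjProd l = wordProd w).card = wordTotal w := by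
  simp only [wordTotal, ← card_posOrderings]
  rw [← card_posOrderings_eq_sum]
  congr 1
  apply filter_congr
  intro l hl
  rw [mem_orderings] at hl
  have h1 : l.length = w.length + 1 := by simpa using hl.length_eq
  have h2 := List.idxOf_lt_length_of_mem (hl.mem_iff.2 (by simp) : w.length ∈ l)
  simp only [mem_range]
  grind

theorem exists_wordProd {t : ℕ} {l : List ℕ} (hl : l.Perm (List.range (t + 1))) :
    ∃ w : List Bool, w.length = t ∧ adjProd l = wordProd w := by
  induction t generalizing l with
  | zero =>
    refine ⟨[], rfl, ?_⟩
    have : l = [0] := List.perm_singleton.1 (by simpa using hl)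
    simp [this, adjProd, wordProd]
  | succ t ih =>
    obtain ⟨a, b, rfl⟩ := List.append_of_mem (hl.mem_iff.2 (by simp) : t + 1 ∈ l)
    rw [perm_insert] at hl
    obtain ⟨w, rfl, hw⟩ := ih hl
    rw [adjProd_insert hl, hw]
    split_ifs
    · exact ⟨true :: w, rfl, rfl⟩
    · exact ⟨false :: w, rfl, rfl⟩

theorem wordProd_map_not (w : List Bool) : wordProd (w.map not) = (wordProd w)⁻¹ := by
  induction w with
  | nil => simp [wordProd, adjSwap]
  | cons b w ih => cases b <;> simp [wordProd, ih, adjSwap]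

theorem wordCount_map_not (w : List Bool) {k : ℕ} (hk : k ≤ w.length) :
    wordCount (w.map not) k = wordCount w (w.length - k) := by
  induction w generalizing k with
  | nil => simp at hk; simp [hk]
  | cons b w ih =>
    simp only [List.length_cons] at hk
    have aux : ∀ p q, q ≤ w.length + 1 → ∑ j ∈ Ico p q, wordCount (w.map not) j =
        ∑ j ∈ Ico (w.length + 1 - q) (w.length + 1 - p), wordCount w j := by
      intro p q hq
      rw [← sum_Ico_reflect _ _ hq]
      refine sum_congr rfl fun j hj => ih ?_
      rw [mem_Ico] at hj
      omega
    cases b with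
    | true =>
      simp only [List.map_cons, Bool.not_true, wordCount, List.length_map, List.length_cons]
      rw [if_pos (Nat.sub_le _ _), aux _ _ le_rfl, Nat.sub_self, range_eq_Ico]
    | false =>
      simp only [List.map_cons, Bool.not_false, wordCount, List.length_map, List.length_cons]
      rw [if_pos hk, range_eq_Ico, aux _ _ hk, Nat.sub_zero]

theorem wordTotal_map_not (w : List Bool) : wordTotal (w.map not) = wordTotal w := by
  rw [wordTotal, wordTotal, ← sum_range_reflect (wordCount w), List.length_map]
  refine sum_congr rfl fun j hj => ?_
  rw [mem_range] at hj
  rw [wordCount_map_not w (by omega), Nat.add_sub_cancel]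

theorem wordTotal_pos (w : List Bool) : 0 < wordTotal w := by
  induction w with
  | nil => simp [wordTotal, wordCount]
  | cons b w ih =>
    cases b with
    | true =>
      refine ih.trans_le ?_
      rw [wordTotal, wordTotal, List.length_cons, sum_range_succ _ (w.length + 1)]
      simp [wordCount]
    | false =>
      refine ih.trans_le ?_
      rw [wordTotal, wordTotal, List.length_cons, sum_range_succ' _ (w.length + 1)]
      simp [wordCount]

/-- The alternating word of a given length with a given head. -/
def altWord : Bool → ℕ → List Bool
  | _, 0 => []
  | b, t + 1 => b :: altWord (!b) t

@[simp] theorem length_altWord (b : Bool) (t : ℕ) : (altWord b t).length = t := by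
  induction t generalizing b with
  | zero => rfl
  | succ t ih => simp [altWord, ih]

theorem map_not_altWord (b : Bool) (t : ℕ) : (altWord b t).map not = altWord (!b) t := by
  induction t generalizing b with
  | zero => rfl
  | succ t ih => simp [altWord, ih]

theorem wordCount_true {w : List Bool} {k : ℕ} (hk : k ≤ w.length + 1) :
    wordCount (true :: w) k = ∑ j ∈ range k, wordCount w j := if_pos hk

theorem wordCount_true_mono (w : List Bool) {i j : ℕ} (hij : i ≤ j) (hj : j ≤ w.length + 1) :
    wordCount (true :: w) i ≤ wordCount (true :: w) j := by
  rw [wordCount_true hj, wordCount_true (hij.trans hj)]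
  exact sum_le_sum_of_subset (range_subset_range.2 hij)

theorem sum_wordCount_true_le (w : List Bool) {k : ℕ} (hk : k ≤ w.length + 2) :
    ∑ j ∈ range k, wordCount (true :: w) j ≤
      ∑ j ∈ range k, wordCount ((true :: w).map not) j := by
  rw [← sum_range_reflect (fun j => wordCount ((true :: w).map not) j)]
  refine sum_le_sum fun j hj => ?_
  rw [mem_range] at hj
  rw [wordCount_map_not _ (by simp only [List.length_cons]; omega)]
  exact wordCount_true_mono w (by simp only [List.length_cons]; omega)
    (by simp only [List.length_cons]; omega)

theorem wordCount_cons_false {w : List Bool} {t k : ℕ} (hw : w.length = t) (hk : k ≤ t + 1) :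
    wordCount (false :: w) k = wordCount (true :: w.map not) (t + 1 - k) := by
  subst hw
  have := wordCount_map_not (true :: w.map not) (k := k) (by simpa using hk)
  simpa [Function.comp_def] using this

theorem wordCount_true_le_altWord {t : ℕ} {w : List Bool} (hw : w.length = t) (k : ℕ) :
    wordCount (true :: w) k ≤ wordCount (true :: altWord false t) k := by
  induction t generalizing w k with
  | zero => rw [List.length_eq_zero_iff.1 hw]; rfl
  | succ t ih =>
    by_cases hk : k ≤ t + 1 + 1
    swap
    · simp [wordCount, hw, hk]
    rw [wordCount_true (by simpa [hw] using hk), wordCount_true (by simpa using hk)]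
    cases w with
    | nil => simp at hw
    | cons b w =>
    replace hw : w.length = t := by simpa using hw
    cases b with
    | true =>
      refine (sum_le_sum fun j _ => ih hw j).trans
        ((sum_wordCount_true_le _ (by simpa using hk)).trans_eq ?_)
      simp [altWord, map_not_altWord]
    | false =>
      refine sum_le_sum fun j hj => ?_
      rw [mem_range] at hj
      rw [altWord, wordCount_cons_false hw (by omega),
        wordCount_cons_false (length_altWord _ _) (by omega), map_not_altWord]
      exact ih (by simpa using hw) _

theorem exists_wordCount_true_lt_altWord {t : ℕ} {w : List Bool} (hw : w.length = t)
    (hne : w ≠ altWord false t) :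
    ∃ k ≤ t + 1, wordCount (true :: w) k < wordCount (true :: altWord false t) k := by
  induction t generalizing w with
  | zero => exact absurd (List.length_eq_zero_iff.1 hw) hne
  | succ t ih =>
    cases w with
    | nil => simp at hw
    | cons b w =>
    replace hw : w.length = t := by simpa using hw
    cases b with
    | true =>
      refine ⟨1, by omega, ?_⟩
      rw [wordCount_true (by simp), wordCount_true (by simp)]
      have := wordTotal_pos (altWord true t)
      rw [wordTotal, length_altWord, range_eq_Ico] at this
      simpa [altWord, wordCount] using this
    | false =>
      have hne' : w.map not ≠ altWord false t := by
        intro h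
        apply hne
        have := congrArg (List.map not) h
        simp only [List.map_map, map_not_altWord] at this
        simpa [altWord, Function.comp_def] using this
      obtain ⟨k, hk, hlt⟩ := ih (by simpa using hw) hne'
      refine ⟨t + 1 + 1, le_rfl, ?_⟩
      rw [wordCount_true (by simp [hw]), wordCount_true (by simp)]
      refine sum_lt_sum (fun j hj => ?_) ⟨t + 1 - k, by rw [mem_range]; omega, ?_⟩
      · rw [mem_range] at hj
        rw [altWord, wordCount_cons_false hw (by omega),
          wordCount_cons_false (length_altWord _ _) (by omega), map_not_altWord]
        exact wordCount_true_le_altWord (by simpa using hw) _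
      · rw [altWord, wordCount_cons_false hw (by omega),
          wordCount_cons_false (length_altWord _ _) (by omega), map_not_altWord, show t + 1 - (t + 1 - k) = k by omega]
        exact hlt

theorem wordTotal_altWord (b : Bool) (t : ℕ) :
    wordTotal (altWord b t) = wordTotal (altWord true t) := by
  cases b
  · rw [← wordTotal_map_not, map_not_altWord]; rfl
  · rfl

/-- Alternating words have strictly more orderings than all other words. -/
theorem wordTotal_lt_altWord {w : List Bool} (h₁ : ∀ b, w ≠ altWord b w.length) :
    wordTotal w < wordTotal (altWord true w.length) := by
  have aux : ∀ v : List Bool, true :: v ≠ altWord true (v.length + 1) →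
      wordTotal (true :: v) < wordTotal (altWord true (v.length + 1)) := by
    intro v hv
    obtain ⟨k, hk, hlt⟩ := exists_wordCount_true_lt_altWord (w := v) rfl
      (fun h => hv (by rw [altWord, Bool.not_true, ← h]))
    simp only [wordTotal, altWord, List.length_cons, length_altWord, Bool.not_true]
    exact sum_lt_sum (fun j _ => wordCount_true_le_altWord rfl j)
      ⟨k, by rw [mem_range]; omega, hlt⟩
  cases w with
  | nil => exact absurd rfl (h₁ true)
  | cons b w =>
    cases b with
    | true => exact aux w (h₁ true)
    | false =>
      rw [← wordTotal_map_not]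
      have := aux (w.map not) (fun h => h₁ false ?_)
      · simpa using this
      · have := congrArg (List.map not) h
        simpa [map_not_altWord, Function.comp_def] using this

/-- The `i`-th edge of a path, with a junk value when there is no such edge. -/
def natPathEdge (t i : ℕ) : Sym2 (Fin (t + 2)) :=
  if h : i < t + 1 then pathEdge (n := t + 2) ⟨i, h⟩ else s(0, 0)

theorem natPathEdge_val {t : ℕ} (i : Fin (t + 2 - 1)) :
    natPathEdge t i.val = pathEdge (n := t + 2) i :=
  dif_pos (show i.val < t + 1 from i.isLt)

theorem inf_natPathEdge {t i : ℕ} (h : i < t + 1) : (natPathEdge t i).inf.val = i := by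
  simp only [natPathEdge, h, dif_pos, pathEdge, Sym2.inf_mk]
  simp [edgeIdx1, edgeIdx2]

theorem listProd_map_natPathEdge {t : ℕ} {l : List ℕ} (h : ∀ i ∈ l, i < t + 1)
    (v : Fin (t + 2)) : (listProd (l.map (natPathEdge t)) v).val = adjProd l v.val := by
  induction l generalizing v with
  | nil => simp [listProd, adjProd]
  | cons i l ih =>
    simp only [List.mem_cons, forall_eq_or_imp] at h
    have h1 : (edgePerm (natPathEdge t i) v).val = adjSwap i v.val := by
      simp only [natPathEdge, h.1, dif_pos, pathEdge, edgePerm, Sym2.lift_mk, edgeIdx1, edgeIdx2,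
        adjSwap, swap_apply_def, Fin.ext_iff]
      split_ifs <;> rfl
    have h2 : listProd ((i :: l).map (natPathEdge t)) =
        listProd (l.map (natPathEdge t)) * edgePerm (natPathEdge t i) := by
      simp [listProd]
    rw [h2, adjProd_cons, Perm.mul_apply, Perm.mul_apply, ih h.2, h1]

theorem isPathOrdering_iff {t : ℕ} {L : List (Sym2 (Fin (t + 2)))} :
    IsPathOrdering (t + 2) L ↔
      ∃ l : List ℕ, l.Perm (List.range (t + 1)) ∧ l.map (natPathEdge t) = L := by
  constructor
  · rintro ⟨hnd, hmem⟩
    have hL : ∀ e ∈ L, natPathEdge t e.inf.val = e ∧ e.inf.val < t + 1 := by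
      intro e he
      obtain ⟨i, rfl⟩ := (hmem e).1 he
      rw [← natPathEdge_val, inf_natPathEdge i.isLt]
      exact ⟨rfl, i.isLt⟩
    have hmap : (L.map fun e => e.inf.val).map (natPathEdge t) = L := by
      rw [List.map_map]
      exact (List.map_congr_left fun e he => (hL e he).1).trans (List.map_id L)
    refine ⟨_, (List.perm_ext_iff_of_nodup ?_ List.nodup_range).2 fun i => ?_, hmap⟩
    · exact List.Nodup.of_map (natPathEdge t) (by rwa [hmap])
    · simp only [List.mem_map, List.mem_range]
      constructor
      · rintro ⟨e, he, rfl⟩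
        exact (hL e he).2
      · intro hi
        refine ⟨natPathEdge t i, (hmem _).2 ⟨⟨i, hi⟩, ?_⟩, inf_natPathEdge hi⟩
        rw [natPathEdge, dif_pos hi]
  · rintro ⟨l, hl, rfl⟩
    refine ⟨?_, fun e => ?_⟩
    · refine (List.nodup_map_iff_inj_on (hl.nodup_iff.2 List.nodup_range)).2 ?_
      intro i hi j hj hij
      rw [← inf_natPathEdge (orderings_lt hl hi), hij, inf_natPathEdge (orderings_lt hl hj)]
    · rw [List.mem_map]
      constructor
      · rintro ⟨i, hi, rfl⟩
        exact ⟨⟨i, orderings_lt hl hi⟩, by rw [natPathEdge, dif_pos (orderings_lt hl hi)]⟩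
      · rintro ⟨i, rfl⟩
        exact ⟨i.val, hl.mem_iff.2 (List.mem_range.2 i.isLt), natPathEdge_val i⟩

theorem listProd_eq_iff {t : ℕ} {w : List Bool} (hw : w.length = t) {c : Perm (Fin (t + 2))}
    (hc : ∀ v : Fin (t + 2), (c v).val = wordProd w v.val) {l : List ℕ}
    (hl : l.Perm (List.range (t + 1))) :
    listProd (l.map (natPathEdge t)) = c ↔ adjProd l = wordProd w := by
  have h := fun v => listProd_map_natPathEdge (t := t) (fun i hi => orderings_lt hl hi) v
  constructor
  · rintro rfl
    ext x
    by_cases hx : x < t + 2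
    · exact (h ⟨x, hx⟩).symm.trans (hc ⟨x, hx⟩)
    · rw [wordProd_apply_of_lt w (by omega), adjProd_apply_of_lt]
      intro i hi
      have := orderings_lt hl hi
      omega
  · intro hlw
    ext v
    rw [h, hc, hlw]

theorem pathMult_eq_wordTotal {t : ℕ} {w : List Bool} (hw : w.length = t)
    {c : Perm (Fin (t + 2))} (hc : ∀ v : Fin (t + 2), (c v).val = wordProd w v.val) :
    pathMult (t + 2) c = wordTotal w := by
  classical
  rw [← card_orderings_wordProd, hw, ← Set.ncard_coe_finset,
    ← Set.InjOn.ncard_image (f := List.map (natPathEdge t)), pathMult]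
  · congr 1
    ext L
    simp only [Set.mem_ofPred_eq, isPathOrdering_iff, Set.mem_image, coe_filter, mem_orderings]
    constructor
    · rintro ⟨⟨l, hl, rfl⟩, hc'⟩
      exact ⟨l, ⟨hl, (listProd_eq_iff hw hc hl).1 hc'⟩, rfl⟩
    · rintro ⟨l, ⟨hl, hlw⟩, rfl⟩
      exact ⟨⟨l, hl, rfl⟩, (listProd_eq_iff hw hc hl).2 hlw⟩
  · intro l hl l' hl' h
    simp only [coe_filter, mem_orderings, Set.mem_ofPred_eq] at hl hl'
    have aux : ∀ l : List ℕ, l.Perm (List.range (t + 1)) →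
        (l.map (natPathEdge t)).map (fun e => e.inf.val) = l := by
      intro l hl
      rw [List.map_map]
      exact (List.map_congr_left fun i hi => inf_natPathEdge (orderings_lt hl hi)).trans
        (List.map_id l)
    rw [← aux l hl.1, h, aux l' hl'.1]

/-- The head of the alternating word of length `t` which describes the canonical cycle. -/
def canonicalHead (t : ℕ) : Bool := decide (t % 2 = 1)

theorem altWord_canonicalHead_succ (t : ℕ) :
    altWord (canonicalHead (t + 1)) (t + 1) =
      canonicalHead (t + 1) :: altWord (canonicalHead t) t := by
  rw [altWord]
  congr 2
  simp only [canonicalHead, ← decide_not, decide_eq_decide]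
  omega

theorem wordProd_altWord_canonicalHead (t v : ℕ) (hv : v < t + 2) :
    wordProd (altWord (canonicalHead t) t) v =
      if v % 2 = 0 then
        (if v + 2 ≤ t + 1 then v + 2 else if (t + 1) % 2 = 1 then t + 1 else t)
      else (if v = 1 then 0 else v - 2) := by
  induction t generalizing v with
  | zero =>
    simp only [altWord, wordProd, adjSwap, swap_apply_def]
    split_ifs <;> omega
  | succ t ih =>
    rw [altWord_canonicalHead_succ]
    have hbig : wordProd (altWord (canonicalHead t) t) (t + 2) = t + 2 :=
      wordProd_apply_of_lt _ (by simp)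
    by_cases ht : t % 2 = 0
    · have : canonicalHead (t + 1) = true := by simp [canonicalHead]; omega
      rw [this, wordProd, length_altWord, Perm.mul_apply]
      by_cases hv' : v < t + 2
      · rw [ih v hv', adjSwap, swap_apply_def]
        split_ifs <;> omega
      · obtain rfl : v = t + 2 := by omega
        rw [hbig, adjSwap, swap_apply_def]
        split_ifs <;> omega
    · have : canonicalHead (t + 1) = false := by simp [canonicalHead]; omega
      rw [this, wordProd, length_altWord, Perm.mul_apply, adjSwap, swap_apply_def]
      split_ifs with h1 h2
      all_goals first
        | rw [hbig]
        | rw [ih _ (by omega)]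
      all_goals (try split_ifs) <;> omega

theorem inv_val_eq_wordProd {t : ℕ} {w : List Bool} {c : Perm (Fin (t + 2))}
    (hc : ∀ v : Fin (t + 2), (c v).val = wordProd w v.val) (v : Fin (t + 2)) :
    (c⁻¹ v).val = wordProd (w.map not) v.val := by
  rw [wordProd_map_not, Perm.eq_inv_iff_eq, ← hc]
  simp

end AlternatingOrderings

/-- Theorem 3.11: for the path on `n+1` vertices (`n ≥ 3`,
0-indexed here), the canonical cycle `c₀` (even 0-indexed vertices in increasing
order followed by the odd ones in decreasing order) and its inverse have the same
multiplicity, and every other realised cycle has strictly smaller multiplicity. -/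
theorem stmt14 (n : ℕ) (hn : 3 ≤ n) (c₀ : Equiv.Perm (Fin (n + 1)))
    (hc₀ : ∀ v : Fin (n + 1), (c₀ v).val =
      if v.val % 2 = 0 then
        (if v.val + 2 ≤ n then v.val + 2 else if n % 2 = 1 then n else n - 1)
      else (if v.val = 1 then 0 else v.val - 2)) :
    pathMult (n + 1) c₀ = pathMult (n + 1) c₀⁻¹ ∧
    ∀ c : Equiv.Perm (Fin (n + 1)),
      (∃ l, IsPathOrdering (n + 1) l ∧ listProd l = c) →
      c ≠ c₀ → c ≠ c₀⁻¹ →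
      pathMult (n + 1) c < pathMult (n + 1) c₀ := by
  obtain ⟨t, rfl⟩ : ∃ t, n = t + 1 := ⟨n - 1, by omega⟩
  have h₀ : ∀ v : Fin (t + 2), (c₀ v).val = wordProd (altWord (canonicalHead t) t) v.val := by
    intro v
    rw [hc₀, wordProd_altWord_canonicalHead t v.val v.isLt, Nat.add_sub_cancel]
  have h₀' : ∀ v : Fin (t + 2), (c₀⁻¹ v).val = wordProd (altWord (!canonicalHead t) t) v.val := by
    intro v
    rw [inv_val_eq_wordProd h₀, map_not_altWord]
  have hm : pathMult (t + 2) c₀ = wordTotal (altWord true t) := by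
    rw [pathMult_eq_wordTotal (length_altWord _ _) h₀, wordTotal_altWord]
  refine ⟨?_, ?_⟩
  · rw [hm, pathMult_eq_wordTotal (length_altWord _ _) h₀', wordTotal_altWord (!_)]
  · rintro c ⟨L, hL, hLc⟩ hne hne'
    obtain ⟨l, hl, rfl⟩ := isPathOrdering_iff.1 hL
    obtain ⟨w, rfl, hw⟩ := exists_wordProd hl
    have hc : ∀ v, (c v).val = wordProd w v.val := by
      intro v
      rw [← hLc, listProd_map_natPathEdge (fun i hi => orderings_lt hl hi), hw]
    rw [hm, pathMult_eq_wordTotal rfl hc]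
    refine wordTotal_lt_altWord fun b hb => ?_
    rcases Bool.eq_or_eq_not b (canonicalHead w.length) with h | h
    · refine hne (Equiv.ext fun v => Fin.ext ?_)
      rw [hc, h₀, ← h, ← hb]
    · refine hne' (Equiv.ext fun v => Fin.ext ?_)
      rw [hc, h₀', ← h, ← hb]
end

section
/- Consider the path on n vertices (n ≥ 4) labeled 1,…,n consecutively. The n-cycle c sending i ↦ i+1 for i < n and n ↦ 1, and its inverse, are each the product of exactly one edge ordering (multiplicity 1), and every other permutation realized as the product of an edge ordering has multiplicity at least 2; hence c and c^{−1} are the least frequent realized cycles. (Proposition 3.13.) -/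
theorem listProd_nil {n : ℕ} : listProd ([] : List (Sym2 (Fin n))) = 1 := rfl

theorem listProd_cons {n : ℕ} (e : Sym2 (Fin n)) (l : List (Sym2 (Fin n))) :
    listProd (e :: l) = listProd l * edgePerm e := by
  simp [listProd]

theorem listProd_append {n : ℕ} (l₁ l₂ : List (Sym2 (Fin n))) :
    listProd (l₁ ++ l₂) = listProd l₂ * listProd l₁ := by
  simp [listProd]

theorem edgePerm_mul_self {n : ℕ} (e : Sym2 (Fin n)) : edgePerm e * edgePerm e = 1 := by
  induction e with
  | _ x y => exact Equiv.swap_mul_self x y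

theorem listProd_reverse {n : ℕ} (l : List (Sym2 (Fin n))) :
    listProd l.reverse = (listProd l)⁻¹ := by
  induction l with
  | nil => simp [listProd_nil]
  | cons e l ih =>
    rw [List.reverse_cons, listProd_append, ih, listProd_cons, listProd_cons, listProd_nil,
      mul_inv_rev, one_mul, inv_eq_of_mul_eq_one_left (edgePerm_mul_self e)]

theorem edgePerm_pathEdge {n : ℕ} (i : Fin (n - 1)) :
    edgePerm (pathEdge i) = Equiv.swap (edgeIdx1 i) (edgeIdx2 i) := rfl

theorem pathEdge_injective {n : ℕ} : Function.Injective (pathEdge (n := n)) := by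
  intro i j h
  simp only [pathEdge, Sym2.eq_iff, edgeIdx1, edgeIdx2, Fin.mk.injEq] at h
  ext
  omega

theorem edgePerm_pathEdge_of_ne {n : ℕ} (i : Fin (n - 1)) (v : Fin n)
    (h₁ : v.val ≠ i.val) (h₂ : v.val ≠ i.val + 1) : edgePerm (pathEdge i) v = v := by
  rw [edgePerm_pathEdge]
  exact Equiv.swap_apply_of_ne_of_ne (fun h => h₁ (congrArg Fin.val h))
    (fun h => h₂ (congrArg Fin.val h))

theorem edgePerm_pathEdge_left {n : ℕ} (i : Fin (n - 1)) (v : Fin n) (h : v.val = i.val) :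
    (edgePerm (pathEdge i) v).val = i.val + 1 := by
  have hv : v = edgeIdx1 i := Fin.ext h
  rw [hv, edgePerm_pathEdge, Equiv.swap_apply_left, edgeIdx2]

theorem edgePerm_pathEdge_right {n : ℕ} (i : Fin (n - 1)) (v : Fin n) (h : v.val = i.val + 1) :
    (edgePerm (pathEdge i) v).val = i.val := by
  have hv : v = edgeIdx2 i := Fin.ext h
  rw [hv, edgePerm_pathEdge, Equiv.swap_apply_right, edgeIdx1]

theorem edgePerm_pathEdge_commute {n : ℕ} (i j : Fin (n - 1))
    (h₁ : i.val ≠ j.val + 1) (h₂ : j.val ≠ i.val + 1) :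
    Commute (edgePerm (pathEdge i)) (edgePerm (pathEdge j)) := by
  rcases eq_or_ne i j with rfl | hij
  · exact Commute.refl _
  · refine Equiv.Perm.Disjoint.commute fun v => ?_
    have hij' : i.val ≠ j.val := fun h => hij (Fin.ext h)
    by_cases hv : v.val = i.val ∨ v.val = i.val + 1
    · exact Or.inr (edgePerm_pathEdge_of_ne j v (by omega) (by omega))
    · exact Or.inl (edgePerm_pathEdge_of_ne i v (by omega) (by omega))

/-- A vertex is fixed by a product of edges none of which is incident to it. -/
theorem listProd_map_pathEdge_of_ne {n : ℕ} (L : List (Fin (n - 1))) (v : Fin n)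
    (h : ∀ i ∈ L, v.val ≠ i.val ∧ v.val ≠ i.val + 1) :
    listProd (L.map pathEdge) v = v := by
  induction L with
  | nil => simp [listProd_nil]
  | cons i L ih =>
    rw [List.map_cons, listProd_cons, Equiv.Perm.mul_apply,
      edgePerm_pathEdge_of_ne i v (h i (by simp)).1 (h i (by simp)).2]
    exact ih fun j hj => h j (List.mem_cons_of_mem i hj)

/-- A product of edges other than the `k`-th one preserves `{v | v ≤ k}`. -/
theorem listProd_map_pathEdge_le {n : ℕ} (L : List (Fin (n - 1))) (k : ℕ) (v : Fin n)
    (h : ∀ i ∈ L, i.val ≠ k) (hv : v.val ≤ k) :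
    (listProd (L.map pathEdge) v).val ≤ k := by
  induction L generalizing v with
  | nil => simpa [listProd_nil] using hv
  | cons i L ih =>
    rw [List.map_cons, listProd_cons, Equiv.Perm.mul_apply]
    refine ih _ (fun j hj => h j (List.mem_cons_of_mem i hj)) ?_
    have hi := h i (by simp)
    by_cases h₁ : v.val = i.val
    · rw [edgePerm_pathEdge_left i v h₁]; omega
    by_cases h₂ : v.val = i.val + 1
    · rw [edgePerm_pathEdge_right i v h₂]; omega
    · rwa [edgePerm_pathEdge_of_ne i v h₁ h₂]

theorem finRotate_val_of_lt {n : ℕ} (v : Fin n) (h : v.val + 1 < n) :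
    (finRotate n v).val = v.val + 1 := by
  obtain ⟨m, rfl⟩ : ∃ m, n = m + 1 := ⟨n - 1, by omega⟩
  exact coe_finRotate_of_ne_last fun hv => by simp [hv] at h

theorem eq_finRotate_of_val {n : ℕ} (c : Equiv.Perm (Fin n))
    (h : ∀ v : Fin n, v.val + 1 < n → (c v).val = v.val + 1) : c = finRotate n := by
  have hlt : ∀ v : Fin n, v.val + 1 < n → c v = finRotate n v := fun v hv =>
    Fin.ext ((h v hv).trans (finRotate_val_of_lt v hv).symm)
  ext1 v
  by_cases hv : v.val + 1 < n
  · exact hlt v hv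
  · obtain ⟨w, hw⟩ := c.surjective (finRotate n v)
    by_cases hw' : w.val + 1 < n
    · have := (finRotate n).injective ((hlt w hw').symm.trans hw)
      exact absurd (this ▸ hw') hv
    · have : w = v := Fin.ext (by omega)
      exact this ▸ hw

/-- The decreasing edge ordering has product `finRotate n`. -/
theorem listProd_of_pairwise_gt {n : ℕ} (L : List (Fin (n - 1))) (hmem : ∀ i, i ∈ L)
    (hL : L.Pairwise (· > ·)) : listProd (L.map pathEdge) = finRotate n := by
  refine eq_finRotate_of_val _ fun v hv => ?_
  let i : Fin (n - 1) := ⟨v.val, by omega⟩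
  obtain ⟨A, B, rfl⟩ := List.append_of_mem (hmem i)
  rw [List.pairwise_append, List.pairwise_cons] at hL
  have hA : ∀ j ∈ A, v.val < j.val := fun j hj => hL.2.2 j hj i (by simp)
  have hB : ∀ j ∈ B, j.val < v.val := fun j hj => hL.2.1.1 j hj
  have hi := edgePerm_pathEdge_left i v rfl
  rw [List.map_append, List.map_cons, listProd_append, listProd_cons, Equiv.Perm.mul_apply,
    Equiv.Perm.mul_apply, listProd_map_pathEdge_of_ne A v
      (fun j hj => by have := hA j hj; omega),
    listProd_map_pathEdge_of_ne B _ (fun j hj => by have := hB j hj; have : i.val = v.val := rfl; omega), hi]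

theorem List.Nodup.pairwise_gt_of_idxOf {m : ℕ} {L : List (Fin m)} (hnd : L.Nodup)
    (h : ∀ i j : Fin m, j.val = i.val + 1 → L.idxOf j < L.idxOf i) :
    L.Pairwise (· > ·) := by
  have key : ∀ (d : ℕ) (i j : Fin m), j.val = i.val + d + 1 → L.idxOf j < L.idxOf i := by
    intro d
    induction d with
    | zero => exact fun i j hij => h i j hij
    | succ d ih =>
      intro i j hij
      let k : Fin m := ⟨i.val + d + 1, by omega⟩
      exact (h k j (by simp only [k]; omega)).trans (ih i k rfl)
  rw [List.pairwise_iff_getElem]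
  intro a b ha hb hab
  by_contra hlt
  have hne : L[a] ≠ L[b] := fun he => hab.ne ((hnd.getElem_inj_iff).1 he)
  have hlt' : L[a].val < L[b].val := lt_of_le_of_ne (not_lt.1 hlt) fun he => hne (Fin.ext he)
  have := key (L[b].val - L[a].val - 1) L[a] L[b] (by omega)
  rw [hnd.idxOf_getElem, hnd.idxOf_getElem] at this
  omega

/-- The decreasing edge ordering is the only one with product `finRotate n`. -/
theorem pairwise_gt_of_listProd_eq {n : ℕ} (L : List (Fin (n - 1))) (hnd : L.Nodup)
    (hmem : ∀ i, i ∈ L) (hc : listProd (L.map pathEdge) = finRotate n) :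
    L.Pairwise (· > ·) := by
  refine hnd.pairwise_gt_of_idxOf fun i j hij => ?_
  obtain ⟨A, B, rfl⟩ := List.append_of_mem (hmem i)
  have hnd' := hnd
  rw [List.nodup_append, List.nodup_cons] at hnd'
  have hiA : i ∉ A := fun hi => hnd'.2.2 i hi i (by simp) rfl
  by_cases hjA : j ∈ A
  · rw [List.idxOf_append_of_mem hjA, List.idxOf_append_of_notMem hiA]
    have := List.idxOf_lt_length_of_mem hjA
    omega
  · exfalso
    let v : Fin n := edgeIdx2 i
    have hv : v.val = i.val + 1 := rfl
    have hA : listProd (A.map pathEdge) v = v := by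
      refine listProd_map_pathEdge_of_ne A v fun k hk => ⟨fun h => ?_, fun h => ?_⟩
      · exact hjA ((Fin.ext (by omega) : k = j) ▸ hk)
      · exact hiA ((Fin.ext (by omega) : k = i) ▸ hk)
    have hle := listProd_map_pathEdge_le B i.val (edgePerm (pathEdge i) v)
      (fun k hk h => hnd'.2.1.1 ((Fin.ext h : k = i) ▸ hk))
      (edgePerm_pathEdge_right i v hv).le
    have hval := finRotate_val_of_lt v (by omega)
    rw [← hc, List.map_append, List.map_cons, listProd_append, listProd_cons,
      Equiv.Perm.mul_apply, Equiv.Perm.mul_apply, hA] at hval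
    omega

theorem isPathOrdering_map {n : ℕ} {L : List (Fin (n - 1))} :
    IsPathOrdering n (L.map pathEdge) ↔ L.Nodup ∧ ∀ i, i ∈ L := by
  rw [IsPathOrdering, List.nodup_map_iff pathEdge_injective]
  refine and_congr_right fun _ => ⟨fun h i => ?_, fun h e => ?_⟩
  · exact (List.mem_map_of_injective pathEdge_injective).1 ((h _).2 ⟨i, rfl⟩)
  · simp [h, eq_comm]

theorem IsPathOrdering.exists_map {n : ℕ} {l : List (Sym2 (Fin n))} (h : IsPathOrdering n l) :
    ∃ L : List (Fin (n - 1)), L.map pathEdge = l ∧ L.Nodup ∧ ∀ i, i ∈ L := by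
  obtain ⟨L, rfl⟩ : ∃ L : List (Fin (n - 1)), L.map pathEdge = l := by
    have : l ∈ Set.range (List.map (pathEdge (n := n))) := by
      rw [Set.range_list_map]
      intro e he
      obtain ⟨i, hi⟩ := (h.2 e).1 he
      exact ⟨i, hi.symm⟩
    exact this
  exact ⟨L, rfl, isPathOrdering_map.1 h⟩

theorem IsPathOrdering.reverse {n : ℕ} {l : List (Sym2 (Fin n))} (h : IsPathOrdering n l) :
    IsPathOrdering n l.reverse :=
  ⟨List.nodup_reverse.2 h.1, fun e => List.mem_reverse.trans (h.2 e)⟩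

theorem pathMult_finRotate (n : ℕ) : pathMult n (finRotate n) = 1 := by
  rw [pathMult, Set.ncard_eq_one]
  have hsorted : (List.finRange (n - 1)).reverse.Pairwise (· > ·) :=
    List.pairwise_reverse.2 (List.pairwise_lt_finRange _)
  refine ⟨(List.finRange (n - 1)).reverse.map pathEdge, Set.eq_singleton_iff_unique_mem.2
    ⟨⟨isPathOrdering_map.2 ⟨List.nodup_reverse.2 (List.nodup_finRange _), by simp⟩,
      listProd_of_pairwise_gt _ (by simp) hsorted⟩, ?_⟩⟩
  rintro l ⟨hl, hc⟩
  obtain ⟨L, rfl, hnd, hmem⟩ := hl.exists_map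
  congr 1
  refine List.Perm.eq_of_pairwise (fun a b _ _ h₁ h₂ => absurd h₁ (lt_asymm h₂))
    (pairwise_gt_of_listProd_eq L hnd hmem hc) hsorted ?_
  rw [List.perm_ext_iff_of_nodup hnd (List.nodup_reverse.2 (List.nodup_finRange _))]
  simp [hmem]

theorem pathMult_inv {n : ℕ} (c : Equiv.Perm (Fin n)) : pathMult n c⁻¹ = pathMult n c := by
  rw [pathMult, pathMult, ← Set.ncard_image_of_injective _ List.reverse_injective]
  congr 1
  ext l
  constructor
  · rintro ⟨l, ⟨hl, hc⟩, rfl⟩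
    exact ⟨hl.reverse, by rw [listProd_reverse, hc, inv_inv]⟩
  · rintro ⟨hl, hc⟩
    exact ⟨l.reverse, ⟨hl.reverse, by rw [listProd_reverse, hc]⟩, l.reverse_reverse⟩

theorem finite_isPathOrdering (n : ℕ) : {l | IsPathOrdering n l}.Finite := by
  exact (List.finite_length_le _ _).subset fun l hl => hl.1.length_le_card

/-- A duplicate-free list in `Fin m` with steps `± 1` has all steps equal. -/
theorem List.IsChain.succ_or_pred {m : ℕ} {L : List (Fin m)} (hnd : L.Nodup)
    (h : L.IsChain fun i j => i.val = j.val + 1 ∨ j.val = i.val + 1) :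
    L.IsChain (fun i j => i.val = j.val + 1) ∨ L.IsChain fun i j => j.val = i.val + 1 := by
  induction L with
  | nil => simp
  | cons a L ih =>
    cases L with
    | nil => simp
    | cons b L =>
      rw [List.isChain_cons_cons] at h
      rw [List.isChain_cons_cons, List.isChain_cons_cons]
      have hab := h.1
      cases L with
      | nil => simpa using hab
      | cons d L =>
        have hne : a.val ≠ d.val := fun he => by
          have := Fin.ext he
          simp [this] at hnd
        rcases ih (List.nodup_cons.1 hnd).2 h.2 with hc | hc
        · refine Or.inl ⟨?_, hc⟩
          have := (List.isChain_cons_cons.1 hc).1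
          omega
        · refine Or.inr ⟨?_, hc⟩
          have := (List.isChain_cons_cons.1 hc).1
          omega

theorem two_le_pathMult {n : ℕ} {c : Equiv.Perm (Fin n)}
    (hc : ∃ l, IsPathOrdering n l ∧ listProd l = c)
    (h₁ : c ≠ finRotate n) (h₂ : c ≠ (finRotate n)⁻¹) : 2 ≤ pathMult n c := by
  obtain ⟨l, hl, hlc⟩ := hc
  obtain ⟨L, rfl, hnd, hmem⟩ := hl.exists_map
  by_cases hch : L.IsChain fun i j => i.val = j.val + 1 ∨ j.val = i.val + 1
  · exfalso
    rcases hch.succ_or_pred hnd with h | h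
    · have hgt : L.Pairwise (· > ·) :=
        List.isChain_iff_pairwise.1 (h.imp fun i j hij => Fin.lt_def.2 (by omega))
      exact h₁ (hlc ▸ listProd_of_pairwise_gt L hmem hgt)
    · have hlt : L.Pairwise (· < ·) :=
        List.isChain_iff_pairwise.1 (h.imp fun i j hij => Fin.lt_def.2 (by omega))
      have := listProd_of_pairwise_gt L.reverse (by simpa using hmem)
        (List.pairwise_reverse.2 hlt)
      rw [List.map_reverse, listProd_reverse, hlc] at this
      exact h₂ (by rw [← this, inv_inv])
  · rw [List.isChain_iff_forall_rel_of_append_cons_cons] at hch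
    push Not at hch
    obtain ⟨i, j, A, B, rfl, hij, hji⟩ := hch
    have hperm : (A ++ j :: i :: B).Perm (A ++ i :: j :: B) :=
      (List.Perm.swap i j B).append_left A
    have hne : i ≠ j := by
      rintro rfl
      exact (List.nodup_cons.1 (List.nodup_append.1 hnd).2.1).1 List.mem_cons_self
    have hfin := (finite_isPathOrdering n).subset
      fun l (hl : IsPathOrdering n l ∧ listProd l = c) => hl.1
    refine (Set.one_lt_ncard_iff hfin).2 ⟨(A ++ i :: j :: B).map pathEdge,
      (A ++ j :: i :: B).map pathEdge, ⟨hl, hlc⟩,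
      ⟨isPathOrdering_map.2 ⟨hperm.nodup_iff.2 hnd, fun k => hperm.mem_iff.2 (hmem k)⟩, ?_⟩, ?_⟩
    · rw [← hlc]
      simp only [List.map_append, List.map_cons, listProd_append, listProd_cons, mul_assoc]
      rw [← mul_assoc (edgePerm (pathEdge i)), (edgePerm_pathEdge_commute i j hij hji).eq,
        mul_assoc]
    · intro he
      have := pathEdge_injective.list_map he
      simp [hne] at this

/-- Proposition 3.13: for the path on `n ≥ 4` vertices (0-indexed),
the full rotation `i ↦ i+1 (mod n)` and its inverse each arise from exactly one
edge ordering, and every other realised permutation has multiplicity at least 2;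
so they are the least frequent realised cycles. -/
theorem stmt15 (n : ℕ) (hn : 4 ≤ n) :
    pathMult n (finRotate n) = 1 ∧
    pathMult n (finRotate n)⁻¹ = 1 ∧
    ∀ c : Equiv.Perm (Fin n),
      (∃ l, IsPathOrdering n l ∧ listProd l = c) →
      c ≠ finRotate n → c ≠ (finRotate n)⁻¹ →
      2 ≤ pathMult n c := by
  exact ⟨pathMult_finRotate n, (pathMult_inv _).trans (pathMult_finRotate n),
    fun _ hc h₁ h₂ => two_le_pathMult hc h₁ h₂⟩
end

section
/- Consider the path on n+1 vertices (n ≥ 4) labeled 1,…,n+1 consecutively. The four cycles (1,2,…,n−1,n+1,n), (1,3,4,…,n,n+1,2) and their inverses each have multiplicity exactly n−1, and every other permutation realized as the product of an edge ordering, apart from the two cycles (1,2,…,n+1)^{±1} of multiplicity 1, has multiplicity strictly greater than n−1; hence these four cycles are the second least frequent realized cycles. (Proposition 3.16.) -/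
namespace PathOrdering

/-- The transposition `(i, i+1)` of `ℕ`. -/
def adjSwap (i : ℕ) : Equiv.Perm ℕ := Equiv.swap i (i + 1)

/-- The product of the adjacent transpositions listed in `l`, the first one applied first. -/
def adjProd (l : List ℕ) : Equiv.Perm ℕ := (l.map adjSwap).reverse.prod

/-- The product of `adjSwap 0, …, adjSwap m` where `adjSwap i` is applied before
`adjSwap (i + 1)` exactly when `w i = true`. -/
def coxeterProd (w : ℕ → Bool) : ℕ → Equiv.Perm ℕ
  | 0 => adjSwap 0
  | m + 1 => if w m then adjSwap (m + 1) * coxeterProd w m else coxeterProd w m * adjSwap (m + 1)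

/-- The list `l` with `x` inserted at position `k`. -/
def insertAt (k x : ℕ) (l : List ℕ) : List ℕ := l.take k ++ x :: l.drop k

/-- The orderings of `0, …, m` in which `i` comes before `i + 1` exactly when `w i = true`. -/
def orderings (w : ℕ → Bool) : ℕ → Finset (List ℕ)
  | 0 => {[0]}
  | m + 1 => (orderings w m).biUnion fun l =>
      ((Finset.range (m + 2)).filter fun k => w m = true ↔ l.idxOf m < k).image
        fun k => insertAt k (m + 1) l

/-- The number of orderings in `orderings w m` in which `m` is at position `k ≤ m`. -/
def endCount (w : ℕ → Bool) : ℕ → ℕ → ℕ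
  | 0, _ => 1
  | m + 1, k => ∑ p ∈ Finset.range (m + 1), if (w m = true ↔ p < k) then endCount w m p else 0

/-- The number of orderings in `orderings w m`. -/
def totalCount (w : ℕ → Bool) (m : ℕ) : ℕ := ∑ k ∈ Finset.range (m + 1), endCount w m k

lemma adjSwap_apply (i v : ℕ) :
    adjSwap i v = if v = i then i + 1 else if v = i + 1 then i else v :=
  Equiv.swap_apply_def _ _ _

lemma adjProd_cons (a : ℕ) (l : List ℕ) : adjProd (a :: l) = adjProd l * adjSwap a := by
  simp [adjProd]

lemma adjProd_append (a b : List ℕ) : adjProd (a ++ b) = adjProd b * adjProd a := by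
  simp [adjProd]

lemma commute_adjSwap {i j : ℕ} (h : j < i) : Commute (adjSwap (i + 1)) (adjSwap j) := by
  ext v
  simp only [Equiv.Perm.mul_apply, adjSwap_apply]
  split_ifs <;> omega

lemma commute_adjSwap_adjProd {i : ℕ} {l : List ℕ} (h : ∀ j ∈ l, j < i) :
    Commute (adjSwap (i + 1)) (adjProd l) := by
  refine Commute.list_prod_right _ _ fun x hx => ?_
  obtain ⟨j, hj, rfl⟩ := List.mem_map.1 (List.mem_reverse.1 hx)
  exact commute_adjSwap (h j hj)

lemma insertAt_perm (k x : ℕ) (l : List ℕ) : (insertAt k x l).Perm (x :: l) := by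
  have := List.perm_middle (a := x) (l₁ := l.take k) (l₂ := l.drop k)
  rwa [List.take_append_drop] at this

lemma idxOf_insertAt {k x : ℕ} {l : List ℕ} (hx : x ∉ l) (hk : k ≤ l.length) :
    (insertAt k x l).idxOf x = k := by
  rw [insertAt, List.idxOf_append, if_neg fun h => hx (List.mem_of_mem_take h)]
  simp [hk]

lemma erase_insertAt {k x : ℕ} {l : List ℕ} (hx : x ∉ l) : (insertAt k x l).erase x = l := by
  rw [insertAt, List.erase_append_right _ fun h => hx (List.mem_of_mem_take h)]
  simp

lemma perm_range_of_mem_orderings {w : ℕ → Bool} {m : ℕ} {l : List ℕ} (h : l ∈ orderings w m) :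
    l.Perm (List.range (m + 1)) := by
  induction m generalizing l with
  | zero => simp_all [orderings]
  | succ m ih =>
    simp only [orderings, Finset.mem_biUnion, Finset.mem_image] at h
    obtain ⟨l, hl, k, -, rfl⟩ := h
    rw [List.range_succ]
    exact (insertAt_perm _ _ _).trans (((ih hl).cons _).trans (List.perm_append_singleton _ _).symm)

lemma mem_iff_of_mem_orderings {w : ℕ → Bool} {m i : ℕ} {l : List ℕ} (h : l ∈ orderings w m) :
    i ∈ l ↔ i ≤ m := by
  rw [(perm_range_of_mem_orderings h).mem_iff, List.mem_range, Nat.lt_succ_iff]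

lemma length_of_mem_orderings {w : ℕ → Bool} {m : ℕ} {l : List ℕ} (h : l ∈ orderings w m) :
    l.length = m + 1 := by
  rw [(perm_range_of_mem_orderings h).length_eq, List.length_range]

lemma nodup_of_mem_orderings {w : ℕ → Bool} {m : ℕ} {l : List ℕ} (h : l ∈ orderings w m) :
    l.Nodup :=
  (perm_range_of_mem_orderings h).nodup_iff.2 List.nodup_range

lemma orderings_congr {w w' : ℕ → Bool} {m : ℕ} (h : ∀ i < m, w i = w' i) :
    orderings w m = orderings w' m := by
  induction m with
  | zero => rfl
  | succ m ih => simp only [orderings, ih fun i hi => h i (by omega), h m (by omega)]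

lemma coxeterProd_congr {w w' : ℕ → Bool} {m : ℕ} (h : ∀ i < m, w i = w' i) :
    coxeterProd w m = coxeterProd w' m := by
  induction m with
  | zero => rfl
  | succ m ih => simp only [coxeterProd, ih fun i hi => h i (by omega), h m (by omega)]

lemma endCount_congr {w w' : ℕ → Bool} {m : ℕ} (h : ∀ i < m, w i = w' i) :
    endCount w m = endCount w' m := by
  induction m with
  | zero => rfl
  | succ m ih =>
    ext k
    simp only [endCount, ih fun i hi => h i (by omega), h m (by omega)]

lemma exists_mem_orderings {m : ℕ} {l : List ℕ} (h : l.Perm (List.range (m + 1))) :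
    ∃ w, l ∈ orderings w m := by
  induction m generalizing l with
  | zero => simpa [orderings] using h
  | succ m ih =>
    obtain ⟨a, b, rfl⟩ := List.append_of_mem (h.mem_iff.2 (List.mem_range.2 (Nat.lt_succ_self _)))
    rw [List.range_succ] at h
    have h' : (a ++ b).Perm (List.range (m + 1)) :=
      (List.perm_middle.symm.trans (h.trans List.perm_append_comm)).cons_inv
    obtain ⟨w, hw⟩ := ih h'
    have hlen := h'.length_eq
    simp only [List.length_append, List.length_range] at hlen
    refine ⟨Function.update w m (decide ((a ++ b).idxOf m < a.length)), ?_⟩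
    simp only [orderings, Finset.mem_biUnion, Finset.mem_image, Finset.mem_filter, Finset.mem_range]
    refine ⟨a ++ b, ?_, a.length, ⟨by omega, by simp⟩, by simp [insertAt]⟩
    rwa [orderings_congr (w' := w)]
    intro i hi
    simp [Function.update_of_ne hi.ne]

lemma adjProd_of_mem_orderings {w : ℕ → Bool} {m : ℕ} {l : List ℕ} (h : l ∈ orderings w m) :
    adjProd l = coxeterProd w m := by
  induction m generalizing l with
  | zero => simp_all [orderings, adjProd, coxeterProd]
  | succ m ih =>
    simp only [orderings, Finset.mem_biUnion, Finset.mem_image, Finset.mem_filter,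
      Finset.mem_range] at h
    obtain ⟨l, hl, k, ⟨-, hk⟩, rfl⟩ := h
    have hnd := nodup_of_mem_orderings hl
    have hm := (mem_iff_of_mem_orderings hl).2 le_rfl
    have hle : ∀ i ∈ l, i ≤ m := fun i hi => (mem_iff_of_mem_orderings hl).1 hi
    rw [← List.mem_take_iff_idxOf_lt hm] at hk
    rw [coxeterProd, ← ih hl, insertAt, adjProd_append, adjProd_cons]
    conv_rhs => rw [← List.take_append_drop k l, adjProd_append]
    rw [← List.take_append_drop k l, List.nodup_append] at hnd
    obtain ⟨-, -, hd⟩ := hnd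
    split_ifs with hw
    · have hc : Commute (adjSwap (m + 1)) (adjProd (l.drop k)) :=
        commute_adjSwap_adjProd fun j hj => lt_of_le_of_ne (hle j (List.mem_of_mem_drop hj))
          fun e => hd m (hk.1 hw) m (e ▸ hj) rfl
      rw [← hc.eq, mul_assoc]
    · have hc : Commute (adjSwap (m + 1)) (adjProd (l.take k)) :=
        commute_adjSwap_adjProd fun j hj => lt_of_le_of_ne (hle j (List.mem_of_mem_take hj))
          fun e => hw (hk.2 (e ▸ hj))
      rw [mul_assoc, hc.eq, mul_assoc]

lemma coxeterProd_apply_last (w : ℕ → Bool) (m : ℕ) :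
    (∀ v, m + 1 < v → coxeterProd w m v = v) ∧ (∀ v ≤ m + 1, coxeterProd w m v ≤ m + 1) ∧
      coxeterProd w m (m + 1) < m + 1 ∧
      ∀ i < m, coxeterProd w m (i + 1) < i + 1 ∧ w i = true ∨
        i + 1 < coxeterProd w m (i + 1) ∧ w i = false := by
  induction m with
  | zero =>
    simp only [coxeterProd, adjSwap_apply]
    refine ⟨fun v hv => ?_, fun v hv => ?_, by simp, by simp⟩ <;> split_ifs <;> omega
  | succ m ih =>
    obtain ⟨h1, h2, h3, h4⟩ := ih
    cases hw : w m <;> simp only [coxeterProd, hw, if_true, Bool.false_eq_true, if_false,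
      Equiv.Perm.mul_apply, adjSwap_apply]
    · refine ⟨fun v hv => ?_, fun v hv => ?_, ?_, fun i hi => ?_⟩
      · rw [if_neg (by omega), if_neg (by omega), h1 v (by omega)]
      · have := h2 v
        have := h1 (m + 1 + 1) (by omega)
        split_ifs <;> omega
      · simp; omega
      · rcases Nat.lt_succ_iff_lt_or_eq.1 hi with hi | rfl
        · rw [if_neg (by omega), if_neg (by omega)]
          exact h4 i hi
        · simp [hw, h1]
    · refine ⟨fun v hv => ?_, fun v hv => ?_, ?_, fun i hi => ?_⟩
      · rw [h1 v (by omega), if_neg (by omega), if_neg (by omega)]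
      · have := h2 v
        have := h1 (m + 1 + 1) (by omega)
        by_cases hv' : v = m + 1 + 1
        · subst hv'; split_ifs <;> omega
        · split_ifs <;> omega
      · simp [h1]
      · rcases Nat.lt_succ_iff_lt_or_eq.1 hi with hi | rfl
        · have := h2 (i + 1)
          refine (h4 i hi).imp (fun h => ⟨?_, h.2⟩) (fun h => ⟨?_, h.2⟩) <;>
            obtain ⟨h, -⟩ := h <;> split_ifs <;> omega
        · left
          refine ⟨?_, hw⟩
          split_ifs <;> omega

lemma eq_of_coxeterProd_eq {w w' : ℕ → Bool} {m : ℕ} (h : coxeterProd w m = coxeterProd w' m) :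
    ∀ i < m, w i = w' i := by
  intro i hi
  have h1 := (coxeterProd_apply_last w m).2.2.2 i hi
  have h2 := (coxeterProd_apply_last w' m).2.2.2 i hi
  rw [h] at h1
  rcases h1 with h1 | h1 <;> rcases h2 with h2 | h2 <;> first | omega | simp [h1.2, h2.2]

lemma mem_orderings_iff {w : ℕ → Bool} {m : ℕ} {l : List ℕ} :
    l ∈ orderings w m ↔ l.Perm (List.range (m + 1)) ∧ adjProd l = coxeterProd w m := by
  refine ⟨fun h => ⟨perm_range_of_mem_orderings h, adjProd_of_mem_orderings h⟩, fun ⟨h, hp⟩ => ?_⟩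
  obtain ⟨w', hw'⟩ := exists_mem_orderings h
  rw [adjProd_of_mem_orderings hw'] at hp
  rwa [← orderings_congr (eq_of_coxeterProd_eq hp)]

lemma card_filter_orderings (w : ℕ → Bool) (m k : ℕ) (hk : k ≤ m) :
    ((orderings w m).filter fun l => l.idxOf m = k).card = endCount w m k := by
  induction m generalizing k with
  | zero =>
    obtain rfl : k = 0 := by omega
    rfl
  | succ m ih =>
    have himage : ((orderings w (m + 1)).filter fun l => l.idxOf (m + 1) = k) =
        ((orderings w m).filter fun l => w m = true ↔ l.idxOf m < k).image
          (insertAt k (m + 1)) := by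
      ext l
      simp only [orderings, Finset.mem_filter, Finset.mem_biUnion, Finset.mem_image,
        Finset.mem_range]
      constructor
      · rintro ⟨⟨l, hl, j, ⟨hj, hj'⟩, rfl⟩, hidx⟩
        rw [idxOf_insertAt (by simp [mem_iff_of_mem_orderings hl])
          (by rw [length_of_mem_orderings hl]; omega)] at hidx
        subst hidx
        exact ⟨l, ⟨hl, hj'⟩, rfl⟩
      · rintro ⟨l, ⟨hl, hj⟩, rfl⟩
        exact ⟨⟨l, hl, k, ⟨by omega, hj⟩, rfl⟩,
          idxOf_insertAt (by simp [mem_iff_of_mem_orderings hl])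
            (by rw [length_of_mem_orderings hl]; omega)⟩
    have hinj : Set.InjOn (insertAt k (m + 1))
        ((orderings w m).filter fun l => w m = true ↔ l.idxOf m < k) := by
      intro l hl l' hl' h
      have hl := mem_iff_of_mem_orderings (i := m + 1) (Finset.mem_filter.1 hl).1
      have hl' := mem_iff_of_mem_orderings (i := m + 1) (Finset.mem_filter.1 hl').1
      rw [← erase_insertAt (k := k) (x := m + 1) (l := l) (by simp [hl]), h,
        erase_insertAt (by simp [hl'])]
    rw [himage, Finset.card_image_of_injOn hinj,
      Finset.card_eq_sum_card_fiberwise (f := fun l => l.idxOf m) (t := Finset.range (m + 1)),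
      endCount]
    · refine Finset.sum_congr rfl fun p hp => ?_
      rw [← ih p (by simpa [Nat.lt_succ_iff] using hp), Finset.filter_filter]
      split_ifs with h
      · congr 1
        refine Finset.filter_congr fun l _ => ⟨fun h => h.2, fun h' => ⟨by rwa [h'], h'⟩⟩
      · rw [Finset.card_eq_zero, Finset.filter_eq_empty_iff]
        rintro l _ ⟨h1, rfl⟩
        exact h h1
    · intro l hl
      have hl := (Finset.mem_filter.1 hl).1
      have := List.idxOf_lt_length_of_mem ((mem_iff_of_mem_orderings hl).2 le_rfl)
      rw [length_of_mem_orderings hl] at this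
      simpa using this

lemma card_orderings (w : ℕ → Bool) (m : ℕ) : (orderings w m).card = totalCount w m := by
  rw [Finset.card_eq_sum_card_fiberwise (f := fun l => l.idxOf m) (t := Finset.range (m + 1)),
    totalCount]
  · exact Finset.sum_congr rfl fun p hp =>
      card_filter_orderings w m p (Nat.lt_succ_iff.1 (Finset.mem_range.1 hp))
  · intro l hl
    have := List.idxOf_lt_length_of_mem ((mem_iff_of_mem_orderings hl).2 le_rfl)
    rw [length_of_mem_orderings hl] at this
    simpa using this

/-- The pattern that equals `b` everywhere except at `j`. -/
def flipAt (b : Bool) (j i : ℕ) : Bool := if i = j then !b else b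

lemma not_flipAt (b : Bool) (j i : ℕ) : (!flipAt b j i) = flipAt (!b) j i := by
  simp only [flipAt]
  split_ifs <;> rfl

lemma coxeterProd_not (w : ℕ → Bool) (m : ℕ) :
    coxeterProd (fun i => !w i) m = (coxeterProd w m)⁻¹ := by
  induction m with
  | zero => simp [coxeterProd, adjSwap]
  | succ m ih => cases h : w m <;> simp [coxeterProd, h, ih, adjSwap]

lemma endCount_not (w : ℕ → Bool) {m k : ℕ} (hk : k ≤ m) :
    endCount (fun i => !w i) m k = endCount w m (m - k) := by
  induction m generalizing k with
  | zero => rfl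
  | succ m ih =>
    simp only [endCount]
    rw [← Finset.sum_range_reflect]
    refine Finset.sum_congr rfl fun p hp => ?_
    have hp := Finset.mem_range.1 hp
    rw [ih (by omega), show m - (m + 1 - 1 - p) = p by omega]
    have : m + 1 - 1 - p < k ↔ ¬ p < m + 1 - k := by omega
    simp only [this]
    by_cases h : p < m + 1 - k <;> cases w m <;> simp [h]

lemma totalCount_not (w : ℕ → Bool) (m : ℕ) :
    totalCount (fun i => !w i) m = totalCount w m := by
  unfold totalCount
  rw [← Finset.sum_range_reflect]
  refine Finset.sum_congr rfl fun p hp => ?_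
  have hp := Finset.mem_range.1 hp
  rw [endCount_not _ (by omega), show m - (m + 1 - 1 - p) = p by omega]

lemma totalCount_congr {w w' : ℕ → Bool} {m : ℕ} (h : ∀ i < m, w i = w' i) :
    totalCount w m = totalCount w' m := by
  simp only [totalCount, endCount_congr h]

lemma endCount_succ_of_true {w : ℕ → Bool} {m k : ℕ} (hw : w m = true) (hk : k ≤ m + 1) :
    endCount w (m + 1) k = ∑ p ∈ Finset.range k, endCount w m p := by
  simp only [endCount, hw, true_iff]
  rw [← Finset.sum_filter]
  refine Finset.sum_congr ?_ fun _ _ => rfl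
  ext p
  simp only [Finset.mem_filter, Finset.mem_range]
  omega

lemma endCount_succ_of_false {w : ℕ → Bool} {m k : ℕ} (hw : w m = false) :
    endCount w (m + 1) k = ∑ p ∈ Finset.Ico k (m + 1), endCount w m p := by
  simp only [endCount, hw, Bool.false_eq_true, false_iff]
  rw [← Finset.sum_filter]
  refine Finset.sum_congr ?_ fun _ _ => rfl
  ext p
  simp only [Finset.mem_filter, Finset.mem_range, Finset.mem_Ico]
  omega

lemma endCount_true {m k : ℕ} (hk : k ≤ m) :
    endCount (fun _ => true) m k = if k = m then 1 else 0 := by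
  induction m generalizing k with
  | zero => simp [endCount]; omega
  | succ m ih =>
    rw [endCount_succ_of_true rfl hk,
      Finset.sum_congr rfl fun p hp => ih (by have := Finset.mem_range.1 hp; omega)]
    rw [Finset.sum_ite_eq']
    simp only [Finset.mem_range]
    congr 1
    exact propext (by omega)

lemma endCount_flipAt_last (m k : ℕ) :
    endCount (flipAt true m) (m + 1) k = if k ≤ m then 1 else 0 := by
  have h : endCount (flipAt true m) m = endCount (fun _ => true) m :=
    endCount_congr fun i hi => by simp [flipAt, hi.ne]
  rw [endCount_succ_of_false (by simp [flipAt]), h, Finset.sum_congr rfl fun p hp =>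
    endCount_true (by have := Finset.mem_Ico.1 hp; omega), Finset.sum_ite_eq']
  simp

lemma endCount_flipAt_zero {m k : ℕ} (hk : k ≤ m + 1) :
    endCount (flipAt true 0) (m + 1) k =
      if k = m + 1 then m else if k = m then 1 else 0 := by
  induction m generalizing k with
  | zero => interval_cases k <;> simp [endCount, flipAt]
  | succ m ih =>
    have h1 : ∀ j ≤ m + 1, ∑ p ∈ Finset.range j, endCount (flipAt true 0) (m + 1) p =
        if j = m + 1 then 1 else 0 := fun j hj => by
      rw [Finset.sum_congr rfl fun p hp => ih (by have := Finset.mem_range.1 hp; omega)]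
      rw [Finset.sum_congr (g := fun p => if p = m then 1 else 0) rfl fun p hp => by
        have := Finset.mem_range.1 hp
        rw [if_neg (by omega)]]
      rw [Finset.sum_ite_eq']
      simp only [Finset.mem_range]
      congr 1
      exact propext (by omega)
    rw [endCount_succ_of_true (by simp [flipAt]) hk]
    rcases Nat.lt_succ_iff_lt_or_eq.1 (Nat.lt_succ_of_le hk) with hk' | rfl
    · rw [h1 k (by omega), if_neg (show k ≠ m + 1 + 1 by omega)]
    · rw [Finset.sum_range_succ, h1 _ le_rfl, ih le_rfl]
      simp [add_comm]

lemma totalCount_true (m : ℕ) : totalCount (fun _ => true) m = 1 := by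
  rw [totalCount, Finset.sum_congr rfl fun p hp =>
    endCount_true (by have := Finset.mem_range.1 hp; omega), Finset.sum_ite_eq']
  simp

lemma totalCount_flipAt_last (m : ℕ) : totalCount (flipAt true m) (m + 1) = m + 1 := by
  rw [totalCount, Finset.sum_congr rfl fun p _ => endCount_flipAt_last m p, Finset.sum_range_succ,
    Finset.sum_congr (g := fun _ => 1) rfl fun p hp => if_pos (by
      have := Finset.mem_range.1 hp; omega)]
  simp

lemma totalCount_flipAt_zero (m : ℕ) : totalCount (flipAt true 0) (m + 1) = m + 1 := by
  rw [totalCount, Finset.sum_congr rfl fun p hp =>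
    endCount_flipAt_zero (by have := Finset.mem_range.1 hp; omega), Finset.sum_range_succ,
    Finset.sum_congr (g := fun p => if p = m then 1 else 0) rfl fun p hp => if_neg (by
      have := Finset.mem_range.1 hp; omega), Finset.sum_ite_eq']
  simp [add_comm]

lemma totalCount_const (b : Bool) (m : ℕ) : totalCount (fun _ => b) m = 1 := by
  cases b
  · rw [← totalCount_true m, ← totalCount_not]; rfl
  · exact totalCount_true m

lemma totalCount_flipAt (b : Bool) (j m : ℕ) :
    totalCount (flipAt (!b) j) m = totalCount (flipAt b j) m := by
  rw [← totalCount_not]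
  simp only [not_flipAt, Bool.not_not]

lemma endCount_succ_last {w : ℕ → Bool} {m : ℕ} (hw : w m = true) :
    endCount w (m + 1) (m + 1) = totalCount w m :=
  endCount_succ_of_true hw le_rfl

lemma totalCount_pos (w : ℕ → Bool) (m : ℕ) : 0 < totalCount w m := by
  induction m generalizing w with
  | zero => simp [totalCount, endCount]
  | succ m ih =>
    suffices h : ∀ w : ℕ → Bool, w m = true → 0 < totalCount w (m + 1) by
      cases hw : w m
      · rw [← totalCount_not]
        exact h _ (by simp [hw])
      · exact h w hw
    intro w hw
    rw [totalCount, Finset.sum_range_succ, endCount_succ_last hw]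
    have := ih w
    omega

lemma exists_endCount_pos {w : ℕ → Bool} {m i : ℕ} (hi : i < m) (hw : w i = false) :
    ∃ p < m, 0 < endCount w m p := by
  induction m with
  | zero => omega
  | succ m ih =>
    cases hm : w m
    · refine ⟨0, by omega, ?_⟩
      rw [endCount_succ_of_false hm, ← Finset.range_eq_Ico]
      exact totalCount_pos w m
    · obtain ⟨p, hp, hpos⟩ := ih (lt_of_le_of_ne (Nat.le_of_lt_succ hi) (by
        rintro rfl; simp [hw] at hm))
      refine ⟨p + 1, by omega, ?_⟩
      rw [endCount_succ_of_true hm (by omega), Finset.sum_range_succ]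
      omega

lemma totalCount_lt_succ {w : ℕ → Bool} {m i : ℕ} (hi : i < m) (hw : w i = !w m) :
    totalCount w m < totalCount w (m + 1) := by
  suffices h : ∀ w : ℕ → Bool, w m = true → w i = false →
      totalCount w m < totalCount w (m + 1) by
    cases hm : w m
    · rw [← totalCount_not, ← totalCount_not w (m + 1)]
      exact h _ (by simp [hm]) (by simp [hw, hm])
    · exact h w hm (by simp [hw, hm])
  intro w hm hw
  obtain ⟨p, hp, hpos⟩ := exists_endCount_pos hi hw
  have h1 : endCount w (m + 1) m = ∑ p ∈ Finset.range m, endCount w m p :=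
    endCount_succ_of_true hm (by omega)
  have h2 : endCount w m p ≤ ∑ p ∈ Finset.range m, endCount w m p :=
    Finset.single_le_sum (fun _ _ => Nat.zero_le _) (Finset.mem_range.2 hp)
  rw [totalCount.eq_1 w (m + 1), Finset.sum_range_succ, endCount_succ_last hm,
    Finset.sum_range_succ]
  omega

/-- The pattern `w` is, on `0, …, m - 1`, neither constant nor constant up to its first or its
last entry. -/
def Generic (w : ℕ → Bool) (m : ℕ) : Prop :=
  ∀ b, (∃ i < m, w i ≠ b) ∧ (∃ i < m, w i ≠ flipAt b 0 i) ∧ ∃ i < m, w i ≠ flipAt b (m - 1) i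

lemma lt_totalCount_of_flipAt_zero {w : ℕ → Bool} {m : ℕ} (hm : 3 ≤ m)
    (hw : ∀ i < m, w i = flipAt true 0 i) (hwm : w m = false) : m + 1 < totalCount w (m + 1) := by
  obtain ⟨k, rfl⟩ : ∃ k, m = k + 1 := ⟨m - 1, by omega⟩
  have hle : ∀ j ∈ Finset.range (k + 2), k ≤ endCount w (k + 1 + 1) j := fun j hj => by
    rw [endCount_succ_of_false hwm, endCount_congr hw]
    refine le_trans ?_ (Finset.single_le_sum (fun _ _ => Nat.zero_le _)
      (Finset.mem_Ico.2 ⟨Nat.le_of_lt_succ (Finset.mem_range.1 hj), Nat.lt_succ_self _⟩))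
    simp [endCount_flipAt_zero]
  have h := Finset.card_nsmul_le_sum _ _ _ hle
  rw [totalCount, Finset.sum_range_succ]
  simp only [Finset.card_range, smul_eq_mul] at h
  nlinarith

lemma lt_totalCount_of_flipAt_last {w : ℕ → Bool} {m : ℕ} (hm : 3 ≤ m)
    (hw : ∀ i < m, w i = flipAt true (m - 1) i) : m + 1 < totalCount w (m + 1) := by
  obtain ⟨k, rfl⟩ : ∃ k, m = k + 1 := ⟨m - 1, by omega⟩
  rw [Nat.add_sub_cancel] at hw
  cases hwm : w (k + 1)
  · have h : ∀ j, endCount w (k + 1 + 1) j = k + 1 - j := fun j => by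
      rw [endCount_succ_of_false hwm, endCount_congr hw]
      simp only [endCount_flipAt_last]
      rw [← Finset.card_filter, ← Nat.card_Ico]
      congr 1
      ext p
      simp only [Finset.mem_filter, Finset.mem_Ico]
      omega
    rw [totalCount, Finset.sum_range_succ', Finset.sum_range_succ', h, h]
    omega
  · have h : ∀ j ≤ k + 1, endCount w (k + 1 + 1) j = j := fun j hj => by
      rw [endCount_succ_of_true hwm (by omega), endCount_congr hw]
      simp only [endCount_flipAt_last]
      rw [← Finset.card_filter, Finset.filter_true_of_mem, Finset.card_range]
      intro p hp
      have := Finset.mem_range.1 hp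
      omega
    rw [totalCount, Finset.sum_range_succ, Finset.sum_range_succ, endCount_succ_last hwm,
      h _ le_rfl, totalCount_congr hw, totalCount_flipAt_last]
    omega

lemma lt_totalCount_of_generic {w : ℕ → Bool} {m : ℕ} (hm : 3 ≤ m) (hw : Generic w m) :
    m < totalCount w m := by
  induction m, hm using Nat.le_induction with
  | base =>
    have h := hw true
    have h' := hw false
    simp only [Nat.exists_lt_succ_right, Nat.not_lt_zero, false_and, exists_false, flipAt] at h h'
    simp only [totalCount, endCount, Finset.sum_range_succ, Finset.sum_range_zero]
    cases h0 : w 0 <;> cases h1 : w 1 <;> cases h2 : w 2 <;> simp [h0, h1, h2] at h h' ⊢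
  | succ m hm ih =>
    by_cases hg : Generic w m
    · obtain ⟨i, hi, hne⟩ := (hw (w m)).1
      have him : i < m := lt_of_le_of_ne (Nat.le_of_lt_succ hi) fun e => hne (e ▸ rfl)
      have := totalCount_lt_succ him (Bool.eq_not.2 hne)
      have := ih hg
      omega
    · simp only [Generic, not_forall] at hg
      obtain ⟨b, hb⟩ := hg
      obtain ⟨⟨i₀, hi₀, h₀⟩, ⟨i₁, hi₁, h₁⟩, ⟨i₂, hi₂, h₂⟩⟩ := hw b
      have hcases : (∀ i < m, w i = b) ∨ (∀ i < m, w i = flipAt b 0 i) ∨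
          ∀ i < m, w i = flipAt b (m - 1) i := by
        by_contra! h
        exact hb h
      rcases hcases with h | h | h
      · exfalso
        rcases Nat.lt_succ_iff_lt_or_eq.1 hi₀ with hi | rfl
        · exact h₀ (h _ hi)
        · rcases Nat.lt_succ_iff_lt_or_eq.1 hi₂ with hi | rfl
          · exact h₂ (by simp [h _ hi, flipAt, hi.ne])
          · exact h₂ (by simpa [flipAt] using Bool.eq_not.2 h₀)
      · have hwm : w m = !b := by
          rcases Nat.lt_succ_iff_lt_or_eq.1 hi₁ with hi | rfl
          · exact absurd (h _ hi) h₁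
          · rw [flipAt, if_neg (by omega)] at h₁
            exact Bool.eq_not.2 h₁
        cases b
        · rw [← totalCount_not]
          refine lt_totalCount_of_flipAt_zero hm (fun i hi => ?_) (by simp [hwm])
          rw [h i hi, not_flipAt, Bool.not_false]
        · exact lt_totalCount_of_flipAt_zero hm h hwm
      · cases b
        · rw [← totalCount_not]
          refine lt_totalCount_of_flipAt_last hm fun i hi => ?_
          rw [h i hi, not_flipAt, Bool.not_false]
        · exact lt_totalCount_of_flipAt_last hm h

lemma coxeterProd_false_apply (m v : ℕ) :
    coxeterProd (fun _ => false) m v =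
      if v ≤ m then v + 1 else if v = m + 1 then 0 else v := by
  induction m generalizing v with
  | zero => simp only [coxeterProd, adjSwap_apply]; split_ifs <;> omega
  | succ m ih =>
    simp only [coxeterProd, Bool.false_eq_true, if_false, Equiv.Perm.mul_apply, adjSwap_apply, ih]
    split_ifs <;> omega

lemma coxeterProd_flipAt_last_apply (m v : ℕ) :
    coxeterProd (flipAt false m) (m + 1) v =
      if v + 1 ≤ m then v + 1 else if v = m then m + 2 else if v = m + 1 then 0
      else if v = m + 2 then m + 1 else v := by
  have h : coxeterProd (flipAt false m) m = coxeterProd (fun _ => false) m :=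
    coxeterProd_congr fun i hi => by simp [flipAt, hi.ne]
  rw [coxeterProd, if_pos (by simp [flipAt]), h]
  simp only [Equiv.Perm.mul_apply, adjSwap_apply, coxeterProd_false_apply]
  split_ifs <;> omega

lemma coxeterProd_flipAt_zero_apply (m v : ℕ) :
    coxeterProd (flipAt false 0) (m + 1) v =
      if v = 0 then 2 else if v = 1 then 0 else if v = m + 2 then 1
      else if v ≤ m + 1 then v + 1 else v := by
  induction m generalizing v with
  | zero =>
    rw [coxeterProd, coxeterProd, if_pos (by simp [flipAt])]
    simp only [Equiv.Perm.mul_apply, adjSwap_apply]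
    split_ifs <;> omega
  | succ m ih =>
    rw [coxeterProd, if_neg (by simp [flipAt])]
    simp only [Equiv.Perm.mul_apply, adjSwap_apply, ih]
    split_ifs <;> first | contradiction | omega

/-- The edge `{i, i + 1}` of the path on `n + 1` vertices, for `i < n`. -/
def natEdge (n i : ℕ) : Sym2 (Fin (n + 1)) := s(Fin.ofNat (n + 1) i, Fin.ofNat (n + 1) (i + 1))

lemma pathEdge_eq_natEdge {n : ℕ} (i : Fin (n + 1 - 1)) : pathEdge i = natEdge n i := by
  have := i.isLt
  have h1 : edgeIdx1 i = Fin.ofNat (n + 1) i := Fin.ext (by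
    simp only [edgeIdx1, Fin.ofNat]; rw [Nat.mod_eq_of_lt]; omega)
  have h2 : edgeIdx2 i = Fin.ofNat (n + 1) (i + 1) := Fin.ext (by
    simp only [edgeIdx2, Fin.ofNat]; rw [Nat.mod_eq_of_lt]; omega)
  rw [pathEdge, natEdge, h1, h2]

lemma pathEdge_injective {n : ℕ} : Function.Injective (pathEdge (n := n)) := by
  intro i j h
  simp only [pathEdge, Sym2.eq_iff, edgeIdx1, edgeIdx2, Fin.mk.injEq] at h
  exact Fin.ext (by omega)

lemma natEdge_injOn (n : ℕ) : Set.InjOn (natEdge n) {i | i < n} := by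
  intro i hi j hj h
  have := @pathEdge_injective (n + 1) ⟨i, hi⟩ ⟨j, hj⟩ (by simpa [pathEdge_eq_natEdge] using h)
  simpa using this

lemma edgePerm_natEdge_apply {n i : ℕ} (hi : i < n) (v : Fin (n + 1)) :
    (edgePerm (natEdge n i) v).val = adjSwap i v := by
  have h : edgePerm (natEdge n i) = Equiv.swap (Fin.ofNat (n + 1) i) (Fin.ofNat (n + 1) (i + 1)) :=
    rfl
  have h1 : i % (n + 1) = i := Nat.mod_eq_of_lt (by omega)
  have h2 : (i + 1) % (n + 1) = i + 1 := Nat.mod_eq_of_lt (by omega)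
  rw [h, Equiv.swap_apply_def, adjSwap_apply]
  simp only [Fin.ext_iff, Fin.ofNat, h1, h2]
  split_ifs <;> rfl

lemma listProd_map_natEdge_apply {n : ℕ} {l : List ℕ} (hl : ∀ i ∈ l, i < n) (v : Fin (n + 1)) :
    (listProd (l.map (natEdge n)) v).val = adjProd l v := by
  induction l generalizing v with
  | nil => simp [listProd, adjProd]
  | cons a l ih =>
    have h : listProd ((a :: l).map (natEdge n)) =
        listProd (l.map (natEdge n)) * edgePerm (natEdge n a) := by simp [listProd]
    rw [h, adjProd_cons, Equiv.Perm.mul_apply, Equiv.Perm.mul_apply,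
      ih fun i hi => hl i (List.mem_cons_of_mem _ hi),
      edgePerm_natEdge_apply (hl a List.mem_cons_self)]

lemma isPathOrdering_iff {n : ℕ} {l : List (Sym2 (Fin (n + 1)))} :
    IsPathOrdering (n + 1) l ↔ ∃ l' : List ℕ, l'.Perm (List.range n) ∧ l'.map (natEdge n) = l := by
  constructor
  · rintro ⟨hnd, hmem⟩
    obtain ⟨l, rfl⟩ : l ∈ Set.range (List.map (pathEdge (n := n + 1))) := by
      rw [Set.range_list_map]
      exact fun e he => ((hmem e).1 he).imp fun i hi => hi.symm
    refine ⟨l.map Fin.val, ?_, ?_⟩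
    · rw [List.perm_ext_iff_of_nodup ((List.Nodup.of_map _ hnd).map Fin.val_injective)
        List.nodup_range]
      intro a
      rw [List.mem_map, List.mem_range]
      constructor
      · rintro ⟨i, -, rfl⟩
        exact i.isLt
      · intro ha
        have := (hmem _).2 ⟨(⟨a, ha⟩ : Fin (n + 1 - 1)), rfl⟩
        rw [List.mem_map_of_injective pathEdge_injective] at this
        exact ⟨_, this, rfl⟩
    · simp [pathEdge_eq_natEdge]
  · rintro ⟨l, hl, rfl⟩
    have hlt : ∀ {i}, i ∈ l ↔ i < n := hl.mem_iff.trans List.mem_range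
    refine ⟨List.Nodup.map_on (fun i hi j hj h => natEdge_injOn n (hlt.1 hi) (hlt.1 hj) h)
      (hl.nodup_iff.2 List.nodup_range), fun e => ?_⟩
    rw [List.mem_map]
    constructor
    · rintro ⟨i, hi, rfl⟩
      exact ⟨⟨i, hlt.1 hi⟩, (pathEdge_eq_natEdge (⟨i, hlt.1 hi⟩ : Fin (n + 1 - 1))).symm⟩
    · rintro ⟨i, rfl⟩
      exact ⟨i, hlt.2 i.isLt, (pathEdge_eq_natEdge i).symm⟩

lemma pathMult_eq_totalCount {w : ℕ → Bool} {m : ℕ} {c : Equiv.Perm (Fin (m + 1 + 1))}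
    (hc : ∀ v, (c v).val = coxeterProd w m v) : pathMult (m + 1 + 1) c = totalCount w m := by
  have himage : {l | IsPathOrdering (m + 1 + 1) l ∧ listProd l = c} =
      List.map (natEdge (m + 1)) '' (orderings w m : Set (List ℕ)) := by
    ext l
    simp only [Set.mem_ofPred_eq, isPathOrdering_iff, Set.mem_image, Finset.mem_coe,
      mem_orderings_iff]
    constructor
    · rintro ⟨⟨l, hl, rfl⟩, hlc⟩
      refine ⟨l, ⟨hl, ?_⟩, rfl⟩
      have hval := listProd_map_natEdge_apply fun i hi => List.mem_range.1 (hl.mem_iff.1 hi)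
      obtain ⟨w', hw'⟩ := exists_mem_orderings hl
      rw [adjProd_of_mem_orderings hw'] at hval ⊢
      ext v
      by_cases hv : v < m + 1 + 1
      · have := hval ⟨v, hv⟩
        rw [hlc, hc] at this
        exact this.symm
      · rw [(coxeterProd_apply_last w' m).1 v (by omega), (coxeterProd_apply_last w m).1 v (by omega)]
    · rintro ⟨l, ⟨hl, hlp⟩, rfl⟩
      refine ⟨⟨l, hl, rfl⟩, Equiv.ext fun v => Fin.ext ?_⟩
      rw [listProd_map_natEdge_apply fun i hi => List.mem_range.1 (hl.mem_iff.1 hi), hlp, hc]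
  rw [pathMult, himage, Set.InjOn.ncard_image, Set.ncard_coe_finset, card_orderings]
  refine Set.LeftInvOn.injOn (f₁' := List.map (Function.invFunOn (natEdge (m + 1)) {i | i < m + 1}))
    fun l hl => ?_
  rw [List.map_map]
  refine (List.map_congr_left fun i hi => ?_).trans l.map_id
  exact (natEdge_injOn (m + 1)).leftInvOn_invFunOn
    (Nat.lt_succ_of_le ((mem_iff_of_mem_orderings hl).1 hi))

lemma inv_apply_val {N : ℕ} {c : Equiv.Perm (Fin N)} {q : Equiv.Perm ℕ}
    (hc : ∀ v, (c v).val = q v) (v : Fin N) : (c⁻¹ v).val = q⁻¹ v := by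
  rw [Equiv.Perm.eq_inv_iff_eq, ← hc]
  simp

lemma eq_of_apply_val {N : ℕ} {c c' : Equiv.Perm (Fin N)} {q : Equiv.Perm ℕ}
    (hc : ∀ v, (c v).val = q v) (hc' : ∀ v, (c' v).val = q v) : c = c' :=
  Equiv.ext fun v => Fin.ext ((hc v).trans (hc' v).symm)

lemma exists_apply_val_eq_coxeterProd {m : ℕ} {l : List (Sym2 (Fin (m + 1 + 1)))}
    (hl : IsPathOrdering (m + 1 + 1) l) : ∃ w, ∀ v, (listProd l v).val = coxeterProd w m v := by
  obtain ⟨l, hperm, rfl⟩ := isPathOrdering_iff.1 hl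
  obtain ⟨w, hw⟩ := exists_mem_orderings hperm
  refine ⟨w, fun v => ?_⟩
  rw [listProd_map_natEdge_apply fun i hi => List.mem_range.1 (hperm.mem_iff.1 hi),
    adjProd_of_mem_orderings hw]

lemma finRotate_apply_val (m : ℕ) (v : Fin (m + 1 + 1)) :
    (finRotate (m + 1 + 1) v).val = coxeterProd (fun _ => false) m v := by
  have := v.isLt
  rw [coe_finRotate, coxeterProd_false_apply]
  simp only [Fin.ext_iff, Fin.val_last]
  split_ifs <;> omega

end PathOrdering

open PathOrdering

/-- Proposition 3.16: for the path on `n+1` vertices (`n ≥ 4`,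
0-indexed here, so 1-indexed label `m` is `m-1 : Fin (n+1)`), the four cycles
`c₁ = (1,2,…,n-1,n+1,n)`, `c₂ = (1,3,4,…,n,n+1,2)` and their inverses each have
multiplicity exactly `n-1`, and every other realised permutation, apart from the
two cycles `(1,2,…,n+1)^{±1}` (the rotations, of multiplicity 1), has multiplicity
strictly greater than `n-1`. -/
theorem stmt16 (n : ℕ) (hn : 4 ≤ n) (c₁ c₂ : Equiv.Perm (Fin (n + 1)))
    (hc₁ : ∀ v : Fin (n + 1), (c₁ v).val =
      if v.val + 3 ≤ n then v.val + 1
      else if v.val = n - 2 then n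
      else if v.val = n - 1 then 0
      else n - 1)
    (hc₂ : ∀ v : Fin (n + 1), (c₂ v).val =
      if v.val = 0 then 2
      else if v.val = 1 then 0
      else if v.val = n then 1
      else v.val + 1) :
    pathMult (n + 1) c₁ = n - 1 ∧
    pathMult (n + 1) c₂ = n - 1 ∧
    pathMult (n + 1) c₁⁻¹ = n - 1 ∧
    pathMult (n + 1) c₂⁻¹ = n - 1 ∧
    pathMult (n + 1) (finRotate (n + 1)) = 1 ∧
    pathMult (n + 1) (finRotate (n + 1))⁻¹ = 1 ∧
    ∀ c : Equiv.Perm (Fin (n + 1)),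
      (∃ l, IsPathOrdering (n + 1) l ∧ listProd l = c) →
      c ≠ c₁ → c ≠ c₂ → c ≠ c₁⁻¹ → c ≠ c₂⁻¹ →
      c ≠ finRotate (n + 1) → c ≠ (finRotate (n + 1))⁻¹ →
      n - 1 < pathMult (n + 1) c := by
  obtain ⟨k, rfl⟩ : ∃ k, n = k + 1 + 1 := ⟨n - 2, by omega⟩
  have h₁ : ∀ v, (c₁ v).val = coxeterProd (flipAt false k) (k + 1) v := fun v => by
    have := v.isLt
    rw [hc₁, coxeterProd_flipAt_last_apply]
    split_ifs <;> omega
  have h₂ : ∀ v, (c₂ v).val = coxeterProd (flipAt false 0) (k + 1) v := fun v => by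
    have := v.isLt
    rw [hc₂, coxeterProd_flipAt_zero_apply]
    split_ifs <;> omega
  have h₃ := finRotate_apply_val (k + 1)
  have h₁' := inv_apply_val h₁
  have h₂' := inv_apply_val h₂
  have h₃' := inv_apply_val h₃
  simp only [← coxeterProd_not, not_flipAt, Bool.not_false] at h₁' h₂' h₃'
  refine ⟨?_, ?_, ?_, ?_, ?_, ?_, ?_⟩
  · rw [pathMult_eq_totalCount h₁, ← totalCount_flipAt, Bool.not_false, totalCount_flipAt_last]
    rfl
  · rw [pathMult_eq_totalCount h₂, ← totalCount_flipAt, Bool.not_false, totalCount_flipAt_zero]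
    rfl
  · rw [pathMult_eq_totalCount h₁', totalCount_flipAt_last]
    rfl
  · rw [pathMult_eq_totalCount h₂', totalCount_flipAt_zero]
    rfl
  · rw [pathMult_eq_totalCount h₃, totalCount_const]
  · rw [pathMult_eq_totalCount h₃', totalCount_const]
  rintro c ⟨l, hl, rfl⟩ hne₁ hne₂ hne₁' hne₂' hne₃ hne₃'
  obtain ⟨w, hw⟩ := exists_apply_val_eq_coxeterProd hl
  rw [pathMult_eq_totalCount hw]
  refine lt_totalCount_of_generic (m := k + 1) (by omega) fun b => ⟨?_, ?_, ?_⟩ <;> by_contra! h <;>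
    rw [coxeterProd_congr (m := k + 1) h] at hw <;> cases b
  · exact hne₃ (eq_of_apply_val hw h₃)
  · exact hne₃' (eq_of_apply_val hw h₃')
  · exact hne₂ (eq_of_apply_val hw h₂)
  · exact hne₂' (eq_of_apply_val hw h₂')
  · exact hne₁ (eq_of_apply_val hw h₁)
  · exact hne₁' (eq_of_apply_val hw h₁')
end
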